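/- arXiv:2409.11943 — 6 statements merged into one kernel-verified Lean document; each statement's English description precedes it below -/
import Mathlib

section
/- Let d ≥ 1 and define the homogeneous weight w₄(z,t) = |z| (|z|⁴+t²)^{−1/2}. There exists a constant C > 0 depending only on d with the following property (smoothing for data in Ker N): if u : ℝ × ℝ^{2d+1} → ℂ is such that u(τ,·) ∈ 𝒮(ℝ^{2d+1}) and N u(τ,·) ≡ 0 for every τ ∈ ℝ, the map τ ↦ u(τ,·) is continuously differentiable as an L²(ℝ^{2d+1})-valued map, and i ∂_τ u(τ,·) = −Δ_H u(τ,·) for all τ, then ∫_ℝ ∫_{ℝ^{2d+1}} w₄(z,t)² |u(τ,z,t)|² dz dt dτ ≤ C ∫_{ℝ^{2d+1}} |u(0,z,t)|² dz dt. -/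
noncomputable section

open MeasureTheory ENNReal

/-- The Heisenberg group ℍ^d modeled on ℝ^d × ℝ^d × ℝ. -/
abbrev Hd (d : ℕ) : Type := EuclideanSpace ℝ (Fin d) × EuclideanSpace ℝ (Fin d) × ℝ

/-- The left-invariant vector field `X_j = ∂_{x_j} + 2 y_j ∂_t`. -/
def Xop (d : ℕ) (j : Fin d) (f : Hd d → ℂ) (p : Hd d) : ℂ :=
  fderiv ℝ f p (EuclideanSpace.single j 1, 0, 2 * p.2.1 j)

/-- The left-invariant vector field `Y_j = ∂_{y_j} - 2 x_j ∂_t`. -/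
def Yop (d : ℕ) (j : Fin d) (f : Hd d → ℂ) (p : Hd d) : ℂ :=
  fderiv ℝ f p (0, EuclideanSpace.single j 1, -(2 * p.1 j))

/-- The vertical derivative `T = ∂_t`. -/
def Tder (d : ℕ) (f : Hd d → ℂ) (p : Hd d) : ℂ :=
  fderiv ℝ f p (0, 0, 1)

/-- The rotation operator `N = Σ_j (y_j ∂_{x_j} - x_j ∂_{y_j})`. -/
def Nop (d : ℕ) (f : Hd d → ℂ) (p : Hd d) : ℂ :=
  fderiv ℝ f p (p.2.1, -p.1, 0)

/-- The sublaplacian `Δ_H = Σ_j (X_j² + Y_j²)`. -/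
def subLap (d : ℕ) (f : Hd d → ℂ) (p : Hd d) : ℂ :=
  ∑ j : Fin d, (Xop d j (Xop d j f) p + Yop d j (Yop d j f) p)

/-- Squared length of the horizontal gradient: `|∇_H f|² = Σ_j (|X_j f|² + |Y_j f|²)`. -/
def gradHsq (d : ℕ) (f : Hd d → ℂ) (p : Hd d) : ℝ :=
  ∑ j : Fin d, (‖Xop d j f p‖ ^ 2 + ‖Yop d j f p‖ ^ 2)

/-- `|z|² = |x|² + |y|²`. -/
def zsq (d : ℕ) (p : Hd d) : ℝ := ‖p.1‖ ^ 2 + ‖p.2.1‖ ^ 2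

/-- `|z|`. -/
def zn (d : ℕ) (p : Hd d) : ℝ := Real.sqrt (zsq d p)

/-- The weight `w₁(z,t) = |z| (1+|z|²)^{-1/2} (1 + (|z|⁴+t²)^{1/2})⁻¹`. -/
def w1 (d : ℕ) (p : Hd d) : ℝ :=
  zn d p / Real.sqrt (1 + zn d p ^ 2) / (1 + Real.sqrt (zn d p ^ 4 + p.2.2 ^ 2))

/-- The weight `w₂(z,t) = (1+|z|²+t²)^{-1/2}`. -/
def w2 (d : ℕ) (p : Hd d) : ℝ :=
  (Real.sqrt (1 + zsq d p + p.2.2 ^ 2))⁻¹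

/-- The weight `w₄(z,t) = |z| (|z|⁴+t²)^{-1/2}`. -/
def w4 (d : ℕ) (p : Hd d) : ℝ :=
  zn d p / Real.sqrt (zn d p ^ 4 + p.2.2 ^ 2)

section

open Set Filter Topology
open scoped ComplexConjugate ContDiff FourierTransform InnerProductSpace LineDeriv SchwartzMap

theorem lp_fourier_ae_eq {H : Type*} [NormedAddCommGroup H] [InnerProductSpace ℂ H]
    [CompleteSpace H] {φ : ℝ → H} (h2 : MemLp φ 2 volume)
    (h1 : Integrable φ) :
    (𝓕 (h2.toLp φ) : Lp H 2 (volume : Measure ℝ)) =ᵐ[volume] 𝓕 φ := by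
  have hcont : Continuous (𝓕 φ) :=
    VectorFourier.fourierIntegral_continuous Real.continuous_fourierChar
      (by exact continuous_inner) h1
  refine ae_eq_of_integral_contDiff_smul_eq
    ((Lp.memLp _).locallyIntegrable (by norm_num)) hcont.locallyIntegrable ?_
  intro g hg hgc
  have hgs : HasCompactSupport (fun x => (g x : ℂ)) := hgc.comp_left (g := ((↑) : ℝ → ℂ)) rfl
  have hgd : ContDiff ℝ ∞ (fun x => (g x : ℂ)) := Complex.ofRealCLM.contDiff.comp hg
  set G : 𝓢(ℝ, ℂ) := hgs.toSchwartzMap hgd with hG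
  have hGx : ∀ x, G x = (g x : ℂ) := fun x => rfl
  have key := congrArg (fun T => T G) (Lp.fourier_toTemperedDistribution_eq (h2.toLp φ))
  simp only [TemperedDistribution.fourier_apply, Lp.toTemperedDistribution_apply] at key
  have e1 : ∀ x, g x • (𝓕 (h2.toLp φ) : Lp H 2 (volume : Measure ℝ)) x
      = G x • (𝓕 (h2.toLp φ) : Lp H 2 (volume : Measure ℝ)) x := fun x => by
    rw [hGx]; exact (Complex.coe_smul _ _).symm
  have e2 : ∀ x, g x • 𝓕 φ x = G x • 𝓕 φ x := fun x => by
    rw [hGx]; exact (Complex.coe_smul _ _).symm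
  simp_rw [e1, e2]
  rw [← key]
  have : ∫ x, 𝓕 G x • (h2.toLp φ : ℝ → H) x = ∫ x, 𝓕 G x • φ x :=
    integral_congr_ae (by filter_upwards [h2.coeFn_toLp] with x hx; rw [hx])
  rw [this, SchwartzMap.fourier_coe]
  have fl : ∀ ξ, 𝓕 φ ξ =
      VectorFourier.fourierIntegral Real.fourierChar volume (innerₗ ℝ).flip φ ξ :=
    fun ξ => by rw [flip_innerₗ]; rfl
  simp_rw [fl]
  exact VectorFourier.integral_fourierIntegral_smul_eq_flip (L := innerₗ ℝ)
    Real.continuous_fourierChar (by exact continuous_inner) (G.integrable (μ := volume)) h1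

theorem lintegral_enorm_fourier_sq {H : Type*} [NormedAddCommGroup H] [InnerProductSpace ℂ H]
    [CompleteSpace H] {φ : ℝ → H} (hc : Continuous φ) (hs : HasCompactSupport φ) :
    ∫⁻ ξ, ‖𝓕 φ ξ‖ₑ ^ 2 = ∫⁻ s, ‖φ s‖ₑ ^ 2 := by
  have h2 : MemLp φ 2 volume := hc.memLp_of_hasCompactSupport hs
  have h1 : Integrable φ := hc.integrable_of_hasCompactSupport hs
  have e : eLpNorm (𝓕 φ) 2 volume = eLpNorm φ 2 volume := by
    rw [← eLpNorm_congr_ae (lp_fourier_ae_eq h2 h1), ← eLpNorm_congr_ae h2.coeFn_toLp]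
    have := Lp.norm_fourier_eq (h2.toLp φ)
    rw [Lp.norm_def, Lp.norm_def] at this
    exact (ENNReal.toReal_eq_toReal_iff' (Lp.eLpNorm_ne_top _) (Lp.eLpNorm_ne_top _)).1 this
  have key : ∀ f : ℝ → H, ∫⁻ x, ‖f x‖ₑ ^ 2 = eLpNorm f 2 volume ^ 2 := fun f => by
    rw [eLpNorm_eq_lintegral_rpow_enorm_toReal (by norm_num) (by norm_num),
      ← ENNReal.rpow_natCast, ← ENNReal.rpow_mul]
    norm_num
  rw [key, key, e]

theorem integrableOn_Ioi_inv_sub_sq {c b : ℝ} (h : c < b) :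
    IntegrableOn (fun ρ : ℝ => ((ρ - c) ^ 2)⁻¹) (Ioi b) ∧
      ∫ ρ in Ioi b, ((ρ - c) ^ 2)⁻¹ = (b - c)⁻¹ := by
  have hd : ∀ x ∈ Ici b, HasDerivAt (fun ρ : ℝ => -(ρ - c)⁻¹) ((x - c) ^ 2)⁻¹ x := by
    intro x hx
    have hx' : x - c ≠ 0 := (sub_pos.2 (h.trans_le hx)).ne'
    have := (((hasDerivAt_id x).sub_const c).inv hx').neg
    refine this.congr_deriv ?_
    rw [neg_div, neg_neg, one_div]
    rfl
  have ht : Tendsto (fun ρ : ℝ => -(ρ - c)⁻¹) atTop (𝓝 0) := by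
    simpa [sub_eq_add_neg] using (tendsto_inv_atTop_zero.comp
      (tendsto_atTop_add_const_right _ (-c) tendsto_id)).neg
  refine ⟨integrableOn_Ioi_deriv_of_nonneg' hd (fun x _ => by positivity) ht, ?_⟩
  rw [integral_Ioi_of_hasDerivAt_of_nonneg' hd (fun x _ => by positivity) ht]
  ring

/-- A family of contractions `S ρ` and a bounded operator `T` satisfying, on a set `G` of pairs
`(g, ℓ)` (thought of as the graph of a positive symmetric operator, homogeneous of degree two under
`S`), the identities behind a dilation-type virial estimate. -/
structure VirialSystem {H : Type*} [NormedAddCommGroup H] [InnerProductSpace ℂ H]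
    (S : ℝ → H →L[ℂ] H) (T : H →L[ℂ] H) (G : Set (H × H)) : Prop where
  norm_le : ∀ ρ : ℝ, 1 ≤ ρ → ∀ x, ρ ^ 2 * ‖S ρ x‖ ≤ ‖x‖
  aestronglyMeasurable : ∀ g l : H,
    AEStronglyMeasurable (fun ρ => ⟪g, S ρ l⟫_ℂ) (volume.restrict (Ioi 1))
  inner_symm : ∀ p ∈ G, ∀ q ∈ G, ⟪q.1, p.2⟫_ℂ = ⟪q.2, p.1⟫_ℂ
  inner_dilation : ∀ ρ : ℝ, 1 ≤ ρ → ∀ p ∈ G, ∀ q ∈ G,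
    (ρ : ℂ) ^ 2 * ⟪q.1, S ρ p.2⟫_ℂ = ⟪q.2, S ρ p.1⟫_ℂ
  inner_le : ∀ ρ : ℝ, 1 ≤ ρ → ∀ p ∈ G, ρ ^ 3 * ‖⟪p.1, S ρ p.2⟫_ℂ‖ ≤ (⟪p.1, p.2⟫_ℂ).re
  norm_sq_le : ∀ p ∈ G, ‖T p.1‖ ^ 2 ≤ ∫ ρ in Ioi (1 : ℝ), ρ * ‖⟪p.1, S ρ p.2⟫_ℂ‖

namespace VirialSystem

variable {H : Type*} [NormedAddCommGroup H] [InnerProductSpace ℂ H]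
  {S : ℝ → H →L[ℂ] H} {T : H →L[ℂ] H} {G : Set (H × H)}

theorem mul_norm_inner_le (h : VirialSystem S T G) {p : H × H} (hp : p ∈ G) {ρ : ℝ} (hρ : 1 ≤ ρ) :
    ρ * ‖⟪p.1, S ρ p.2⟫_ℂ‖ ≤ (⟪p.1, p.2⟫_ℂ).re * ((ρ - 0) ^ 2)⁻¹ := by
  have h0 : 0 < ρ := by linarith
  rw [sub_zero, ← div_eq_mul_inv, le_div_iff₀ (by positivity)]
  linarith [h.inner_le ρ hρ p hp]

protected theorem closure (h : VirialSystem S T G) : VirialSystem S T (closure G) where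
  norm_le := h.norm_le
  aestronglyMeasurable := h.aestronglyMeasurable
  inner_symm := by
    intro p hp q hq
    obtain ⟨a, ha, hap⟩ := mem_closure_iff_seq_limit.1 hp
    obtain ⟨b, hb, hbq⟩ := mem_closure_iff_seq_limit.1 hq
    refine tendsto_nhds_unique ((hbq.fst_nhds).inner (𝕜 := ℂ) hap.snd_nhds)
      (((hbq.snd_nhds).inner (𝕜 := ℂ) hap.fst_nhds).congr fun n => ?_)
    exact (h.inner_symm _ (ha n) _ (hb n)).symm
  inner_dilation := by
    intro ρ hρ p hp q hq
    obtain ⟨a, ha, hap⟩ := mem_closure_iff_seq_limit.1 hp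
    obtain ⟨b, hb, hbq⟩ := mem_closure_iff_seq_limit.1 hq
    refine tendsto_nhds_unique (((hbq.fst_nhds).inner (𝕜 := ℂ)
      (((S ρ).continuous.tendsto _).comp hap.snd_nhds)).const_mul _)
      (((hbq.snd_nhds).inner (𝕜 := ℂ)
        (((S ρ).continuous.tendsto _).comp hap.fst_nhds)).congr fun n => ?_)
    exact (h.inner_dilation ρ hρ _ (ha n) _ (hb n)).symm
  inner_le := by
    intro ρ hρ p hp
    obtain ⟨a, ha, hap⟩ := mem_closure_iff_seq_limit.1 hp
    refine le_of_tendsto_of_tendsto' (((hap.fst_nhds).inner (𝕜 := ℂ)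
      (((S ρ).continuous.tendsto _).comp hap.snd_nhds)).norm.const_mul _)
      ((Complex.continuous_re.tendsto _).comp ((hap.fst_nhds).inner (𝕜 := ℂ) hap.snd_nhds))
      fun n => ?_
    exact h.inner_le ρ hρ _ (ha n)
  norm_sq_le := by
    intro p hp
    obtain ⟨a, ha, hap⟩ := mem_closure_iff_seq_limit.1 hp
    have hre := (Complex.continuous_re.tendsto _).comp
      ((hap.fst_nhds).inner (𝕜 := ℂ) hap.snd_nhds)
    obtain ⟨M, hM⟩ := hre.bddAbove_range
    have hM' : ∀ n, (⟪(a n).1, (a n).2⟫_ℂ).re ≤ M := fun n => hM ⟨n, rfl⟩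
    refine le_of_tendsto_of_tendsto'
      ((((T.continuous.tendsto _).comp hap.fst_nhds).norm).pow 2)
      (tendsto_integral_of_dominated_convergence (fun ρ : ℝ => M * ((ρ - 0) ^ 2)⁻¹)
        (F := fun n ρ => ρ * ‖⟪(a n).1, S ρ (a n).2⟫_ℂ‖) ?_ ?_ ?_ ?_)
      fun n => h.norm_sq_le _ (ha n)
    · exact fun n => aestronglyMeasurable_id.mul (h.aestronglyMeasurable _ _).norm
    · exact (integrableOn_Ioi_inv_sub_sq one_pos).1.const_mul M
    · refine fun n => (ae_restrict_mem measurableSet_Ioi).mono fun ρ hρ => ?_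
      have hρ : (1 : ℝ) < ρ := hρ
      rw [Real.norm_of_nonneg (mul_nonneg (by linarith) (norm_nonneg _))]
      exact (h.mul_norm_inner_le (ha n) hρ.le).trans
        (mul_le_mul_of_nonneg_right (hM' n) (by positivity))
    · refine ae_of_all _ fun ρ => ?_
      exact ((hap.fst_nhds).inner (𝕜 := ℂ)
        (((S ρ).continuous.tendsto _).comp hap.snd_nhds)).norm.const_mul _

/-- If `ℓ = λ g + f` and `ℓ' = λ f + f₂` then `⟪g, S ρ ℓ⟫` is small away from `ρ = 1`. -/
theorem mul_norm_inner_le_of_eq (h : VirialSystem S T G) {g l f l' f₂ : H}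
    (hg : (g, l) ∈ G) (hf : (f, l') ∈ G) {c : ℝ} (hc : 0 < c)
    (hl : l = (c : ℂ) • g + f) (hl' : l' = (c : ℂ) • f + f₂) {ρ : ℝ} (hρ : 1 < ρ) :
    ρ * ‖⟪g, S ρ l⟫_ℂ‖ ≤ (‖g‖ * ‖f₂‖ + ‖f‖ ^ 2) / c * ((ρ - 1) ^ 2)⁻¹ := by
  have e1 := h.inner_dilation ρ hρ.le _ hg _ hg
  have e2 := h.inner_dilation ρ hρ.le _ hf _ hg
  have e3 := h.inner_dilation ρ hρ.le _ hg _ hf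
  simp only at e1 e2 e3
  have k0 : ⟪g, S ρ l⟫_ℂ = c * ⟪g, S ρ g⟫_ℂ + ⟪g, S ρ f⟫_ℂ := by
    rw [hl, map_add, map_smul, inner_add_right, inner_smul_right]
  have k1 : ⟪g, S ρ l'⟫_ℂ = c * ⟪g, S ρ f⟫_ℂ + ⟪g, S ρ f₂⟫_ℂ := by
    rw [hl', map_add, map_smul, inner_add_right, inner_smul_right]
  have k2 : ⟪f, S ρ l⟫_ℂ = c * ⟪f, S ρ g⟫_ℂ + ⟪f, S ρ f⟫_ℂ := by
    rw [hl, map_add, map_smul, inner_add_right, inner_smul_right]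
  have k3 : ⟪l, S ρ g⟫_ℂ = c * ⟪g, S ρ g⟫_ℂ + ⟪f, S ρ g⟫_ℂ := by
    rw [hl, inner_add_left, inner_smul_left, Complex.conj_ofReal]
  have k4 : ⟪l, S ρ f⟫_ℂ = c * ⟪g, S ρ f⟫_ℂ + ⟪f, S ρ f⟫_ℂ := by
    rw [hl, inner_add_left, inner_smul_left, Complex.conj_ofReal]
  have k5 : ⟪l', S ρ g⟫_ℂ = c * ⟪f, S ρ g⟫_ℂ + ⟪f₂, S ρ g⟫_ℂ := by
    rw [hl', inner_add_left, inner_smul_left, Complex.conj_ofReal]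
  have id : (((ρ ^ 2 - 1) ^ 2 * c : ℝ) : ℂ) * ⟪g, S ρ l⟫_ℂ
      = ⟪f₂, S ρ g⟫_ℂ + (ρ : ℂ) ^ 2 * ⟪g, S ρ f₂⟫_ℂ - ((ρ : ℂ) ^ 2 + 1) * ⟪f, S ρ f⟫_ℂ := by
    push_cast
    rw [k1, k4] at e2
    rw [k2, k5] at e3
    rw [k3] at e1
    linear_combination ((ρ : ℂ) ^ 2 - 1) * c * (e1 - k0) + e3 - e2
  have hρ0 : 0 < ρ := by linarith
  have hn : ∀ x y : H, ρ ^ 2 * ‖⟪x, S ρ y⟫_ℂ‖ ≤ ‖x‖ * ‖y‖ := fun x y => by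
    have := mul_le_mul_of_nonneg_left (norm_inner_le_norm (𝕜 := ℂ) x (S ρ y)) (sq_nonneg ρ)
    have := mul_le_mul_of_nonneg_left (h.norm_le ρ hρ.le y) (norm_nonneg x)
    nlinarith
  have nid : ((ρ ^ 2 - 1) ^ 2 * c) * ‖⟪g, S ρ l⟫_ℂ‖ ≤
      ‖⟪f₂, S ρ g⟫_ℂ‖ + ρ ^ 2 * ‖⟪g, S ρ f₂⟫_ℂ‖ + (ρ ^ 2 + 1) * ‖⟪f, S ρ f⟫_ℂ‖ := by
    have := congrArg norm id
    rw [norm_mul, Complex.norm_of_nonneg (by positivity)] at this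
    rw [this]
    have h1 : ‖((ρ : ℂ) ^ 2 + 1)‖ = ρ ^ 2 + 1 := by
      rw [← Complex.norm_of_nonneg (show (0 : ℝ) ≤ ρ ^ 2 + 1 by positivity)]; norm_cast
    have h2 : ‖((ρ : ℂ) ^ 2)‖ = ρ ^ 2 := by
      rw [← Complex.norm_of_nonneg (show (0 : ℝ) ≤ ρ ^ 2 by positivity)]; norm_cast
    refine (norm_sub_le _ _).trans ?_
    rw [norm_mul, h1]
    refine add_le_add_left ((norm_add_le _ _).trans ?_) _
    rw [norm_mul, h2]
  set K := ‖g‖ * ‖f₂‖ + ‖f‖ ^ 2 with hK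
  have hK0 : 0 ≤ K := by positivity
  have b : ρ ^ 2 * (((ρ ^ 2 - 1) ^ 2 * c) * ‖⟪g, S ρ l⟫_ℂ‖) ≤ (1 + ρ ^ 2) * K := by
    have h1 := hn f₂ g
    have h2 := hn g f₂
    have h3 := hn f f
    calc _ ≤ ρ ^ 2 * (‖⟪f₂, S ρ g⟫_ℂ‖ + ρ ^ 2 * ‖⟪g, S ρ f₂⟫_ℂ‖
          + (ρ ^ 2 + 1) * ‖⟪f, S ρ f⟫_ℂ‖) := mul_le_mul_of_nonneg_left nid (by positivity)
      _ = ρ ^ 2 * ‖⟪f₂, S ρ g⟫_ℂ‖ + ρ ^ 2 * (ρ ^ 2 * ‖⟪g, S ρ f₂⟫_ℂ‖)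
          + (ρ ^ 2 + 1) * (ρ ^ 2 * ‖⟪f, S ρ f⟫_ℂ‖) := by ring
      _ ≤ ‖f₂‖ * ‖g‖ + ρ ^ 2 * (‖g‖ * ‖f₂‖) + (ρ ^ 2 + 1) * (‖f‖ * ‖f‖) := by gcongr
      _ = (1 + ρ ^ 2) * K := by rw [hK]; ring
  have hpos : 0 < (ρ - 1) ^ 2 := by have := sub_pos.2 hρ; positivity
  rw [← div_eq_mul_inv, le_div_iff₀ hpos, le_div_iff₀ hc]
  have b2 : ρ * (ρ + 1) ^ 2 * (ρ * ‖⟪g, S ρ l⟫_ℂ‖ * (ρ - 1) ^ 2 * c) ≤ ρ * (ρ + 1) ^ 2 * K := by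
    calc _ = ρ ^ 2 * (((ρ ^ 2 - 1) ^ 2 * c) * ‖⟪g, S ρ l⟫_ℂ‖) := by ring
      _ ≤ (1 + ρ ^ 2) * K := b
      _ ≤ _ := mul_le_mul_of_nonneg_right (by nlinarith) hK0
  exact le_of_mul_le_mul_left b2 (by positivity)

theorem re_inner_le {g l f : H} {c : ℝ} (hl : l = (c : ℂ) • g + f) :
    (⟪g, l⟫_ℂ).re ≤ c * ‖g‖ ^ 2 + ‖f‖ * ‖g‖ := by
  have h2 : (⟪g, f⟫_ℂ).re ≤ ‖g‖ * ‖f‖ :=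
    (Complex.re_le_norm _).trans (norm_inner_le_norm _ _)
  have h3 : (⟪g, l⟫_ℂ).re = c * ‖g‖ ^ 2 + (⟪g, f⟫_ℂ).re := by
    rw [hl, inner_add_right, inner_smul_right, inner_self_eq_norm_sq_to_K, Complex.add_re]
    congr 1
    rw [← Complex.ofReal_re (c * ‖g‖ ^ 2)]
    push_cast
    rfl
  linarith

theorem integrableOn (h : VirialSystem S T G) {p : H × H} (hp : p ∈ G) :
    IntegrableOn (fun ρ => ρ * ‖⟪p.1, S ρ p.2⟫_ℂ‖) (Ioi 1) := by
  refine ((integrableOn_Ioi_inv_sub_sq one_pos).1.const_mul (⟪p.1, p.2⟫_ℂ).re).mono'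
    (aestronglyMeasurable_id.mul (h.aestronglyMeasurable _ _).norm)
    ((ae_restrict_mem measurableSet_Ioi).mono fun ρ hρ => ?_)
  have hρ : (1 : ℝ) < ρ := hρ
  rw [Real.norm_of_nonneg (mul_nonneg (by linarith) (norm_nonneg _))]
  exact h.mul_norm_inner_le hp hρ.le

theorem norm_sq_le_of_eq (h : VirialSystem S T G) {g l f l' f₂ : H}
    (hg : (g, l) ∈ G) (hf : (f, l') ∈ G) {c ε : ℝ} (hε : 0 < ε)
    (hl : l = (c : ℂ) • g + f) (hl' : l' = (c : ℂ) • f + f₂) :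
    ‖T g‖ ^ 2 ≤ 2 * (ε * ‖g‖ ^ 2 + ε⁻¹ * ‖f‖ ^ 2 + ε⁻¹ ^ 3 * ‖f₂‖ ^ 2) := by
  have hM := re_inner_le hl
  have hint := h.integrableOn hg
  have hT := h.norm_sq_le _ hg
  simp only at hint hT
  have am1 : ‖f‖ * ‖g‖ ≤ (ε * ‖g‖ ^ 2 + ε⁻¹ * ‖f‖ ^ 2) / 2 := by
    have := mul_nonneg (inv_nonneg.2 hε.le) (sq_nonneg (ε * ‖g‖ - ‖f‖))
    have e : ε⁻¹ * (ε * ‖g‖ - ‖f‖) ^ 2 = ε * ‖g‖ ^ 2 - 2 * (‖f‖ * ‖g‖) + ε⁻¹ * ‖f‖ ^ 2 := by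
      field_simp
      ring
    linarith
  have am2 : ‖g‖ * ‖f₂‖ / ε ≤ (ε * ‖g‖ ^ 2 + ε⁻¹ ^ 3 * ‖f₂‖ ^ 2) / 2 := by
    have := mul_nonneg (pow_nonneg (inv_nonneg.2 hε.le) 3) (sq_nonneg (ε ^ 2 * ‖g‖ - ‖f₂‖))
    have e : ε⁻¹ ^ 3 * (ε ^ 2 * ‖g‖ - ‖f₂‖) ^ 2
        = ε * ‖g‖ ^ 2 - 2 * (‖g‖ * ‖f₂‖ / ε) + ε⁻¹ ^ 3 * ‖f₂‖ ^ 2 := by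
      field_simp
      ring
    linarith
  have n1 : 0 ≤ ε * ‖g‖ ^ 2 := by positivity
  have n2 : 0 ≤ ε⁻¹ * ‖f‖ ^ 2 := by positivity
  have n3 : 0 ≤ ε⁻¹ ^ 3 * ‖f₂‖ ^ 2 := by positivity
  rcases le_total c ε with hcε | hcε
  · have : ∫ ρ in Ioi (1 : ℝ), ρ * ‖⟪g, S ρ l⟫_ℂ‖ ≤ (⟪g, l⟫_ℂ).re := by
      have h1 := (integrableOn_Ioi_inv_sub_sq (one_pos (α := ℝ)))
      have := setIntegral_mono_on hint (h1.1.const_mul (⟪g, l⟫_ℂ).re) measurableSet_Ioi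
        fun ρ hρ => h.mul_norm_inner_le hg (le_of_lt hρ)
      rw [integral_const_mul, h1.2] at this
      simpa using this
    have : c * ‖g‖ ^ 2 ≤ ε * ‖g‖ ^ 2 := by gcongr
    linarith
  · have hc : 0 < c := hε.trans_le hcε
    set η := ε / c with hη
    have hη0 : 0 < η := by positivity
    set M := (⟪g, l⟫_ℂ).re
    set K := ‖g‖ * ‖f₂‖ + ‖f‖ ^ 2
    have hu : Ioi (1 : ℝ) = Ioc 1 (1 + η) ∪ Ioi (1 + η) := (Ioc_union_Ioi_eq_Ioi (by linarith)).symm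
    have hi1 := hint.mono_set (show Ioc 1 (1 + η) ⊆ Ioi 1 from Ioc_subset_Ioi_self)
    have hi2 := hint.mono_set (show Ioi (1 + η) ⊆ Ioi 1 from Ioi_subset_Ioi (by linarith))
    have hM0 : 0 ≤ M := by
      have := h.inner_le 1 le_rfl _ hg
      exact le_trans (by positivity) this
    have b1 : ∫ ρ in Ioc 1 (1 + η), ρ * ‖⟪g, S ρ l⟫_ℂ‖ ≤ M * η := by
      have := setIntegral_mono_on hi1 (integrableOn_const (C := M) (by simp) (by simp))
        measurableSet_Ioc fun ρ hρ => by
          refine (h.mul_norm_inner_le hg hρ.1.le).trans (mul_le_of_le_one_right hM0 ?_)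
          have : 1 ≤ (ρ - 0) ^ 2 := by nlinarith [hρ.1]
          exact inv_le_one_of_one_le₀ this
      refine this.trans_eq ?_
      rw [setIntegral_const]
      simp [Measure.real, hη0.le, mul_comm]
    have b2 : ∫ ρ in Ioi (1 + η), ρ * ‖⟪g, S ρ l⟫_ℂ‖ ≤ K / ε := by
      have h1 := integrableOn_Ioi_inv_sub_sq (show (1 : ℝ) < 1 + η by linarith)
      have := setIntegral_mono_on hi2 (h1.1.const_mul (K / c)) measurableSet_Ioi
        fun ρ hρ => h.mul_norm_inner_le_of_eq hg hf hc hl hl'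
          (show 1 < ρ by have : 1 + η < ρ := hρ; linarith)
      rw [integral_const_mul, h1.2] at this
      refine this.trans_eq ?_
      rw [hη, add_sub_cancel_left]; field_simp
    rw [hu, setIntegral_union (Ioc_disjoint_Ioi le_rfl) measurableSet_Ioi hi1 hi2] at hT
    have b3 : M * η ≤ ε * ‖g‖ ^ 2 + ‖f‖ * ‖g‖ := by
      have hη1 : η ≤ 1 := by rw [hη]; exact div_le_one_of_le₀ hcε hc.le
      calc M * η ≤ (c * ‖g‖ ^ 2 + ‖f‖ * ‖g‖) * η := by gcongr
        _ = ε * ‖g‖ ^ 2 + ‖f‖ * ‖g‖ * η := by rw [hη]; field_simp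
        _ ≤ _ := by
          have : ‖f‖ * ‖g‖ * η ≤ ‖f‖ * ‖g‖ := mul_le_of_le_one_right (by positivity) hη1
          linarith
    have b4 : K / ε = ‖g‖ * ‖f₂‖ / ε + ε⁻¹ * ‖f‖ ^ 2 := by
      simp only [K]; field_simp
    linarith

theorem norm_eq {K : Submodule ℂ (H × H)} (h : VirialSystem S T (K : Set (H × H)))
    {U V : ℝ → H} (hU : ∀ s, HasDerivAt U (V s) s)
    (hK : ∀ s, (U s, Complex.I • V s) ∈ K) (s : ℝ) : ‖U s‖ = ‖U 0‖ := by
  have hd : ∀ s, HasDerivAt (fun s => ⟪U s, U s⟫_ℂ) 0 s := fun s => by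
    refine ((hU s).inner ℂ (hU s)).congr_deriv ?_
    have := h.inner_symm _ (hK s) _ (hK s)
    simp only [inner_smul_right, inner_smul_left, Complex.conj_I] at this
    linear_combination -Complex.I * this + (⟪U s, V s⟫_ℂ + ⟪V s, U s⟫_ℂ) * Complex.I_mul_I
  have := is_const_of_deriv_eq_zero (fun s => (hd s).differentiableAt) (fun s => (hd s).deriv) s 0
  simp only [inner_self_eq_norm_sq_to_K] at this
  have h2 : ‖U s‖ ^ 2 = ‖U 0‖ ^ 2 := by exact_mod_cast this
  exact (pow_left_inj₀ (norm_nonneg _) (norm_nonneg _) two_ne_zero).1 h2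

end VirialSystem

section
variable {H : Type*} [NormedAddCommGroup H] [InnerProductSpace ℂ H] [CompleteSpace H]

theorem Submodule.integral_mem_of_isClosed {E : Type*} [NormedAddCommGroup E] [NormedSpace ℂ E]
    [CompleteSpace E] (K : Submodule ℂ E) (hK : IsClosed (K : Set E))
    {φ : ℝ → E} (hc : Continuous φ) (hs : HasCompactSupport φ) (hφ : ∀ s, φ s ∈ K) :
    ∫ s, φ s ∈ K := by
  have : CompleteSpace K := hK.completeSpace_coe
  set ψ : ℝ → K := fun s => ⟨φ s, hφ s⟩ with hψ
  have hψc : Continuous ψ := hc.subtype_mk hφ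
  have hψs : HasCompactSupport ψ := by
    refine hs.mono' (subset_trans (fun s hs => ?_) subset_closure)
    simpa [hψ, Function.mem_support, Subtype.ext_iff] using hs
  have h := K.subtypeL.integral_comp_comm
    (hψc.integrable_of_hasCompactSupport (μ := volume) hψs)
  have h' : ∫ s, φ s = K.subtypeL (∫ s, ψ s) := h
  rw [h']
  exact (∫ s, ψ s).2

theorem fourier_mem_of_isClosed (K : Submodule ℂ (H × H)) (hK : IsClosed (K : Set (H × H)))
    {φ ψ : ℝ → H} (hφ : Continuous φ) (hφs : HasCompactSupport φ) (hψ : Continuous ψ)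
    (hψs : HasCompactSupport ψ) (h : ∀ s, (φ s, ψ s) ∈ K) (ξ : ℝ) :
    (𝓕 φ ξ, 𝓕 ψ ξ) ∈ K := by
  have hφ1 := (Real.fourierIntegral_convergent_iff ξ).2
    (hφ.integrable_of_hasCompactSupport (μ := volume) hφs)
  have hψ1 := (Real.fourierIntegral_convergent_iff ξ).2
    (hψ.integrable_of_hasCompactSupport (μ := volume) hψs)
  rw [Real.fourier_eq, Real.fourier_eq, ← integral_pair hφ1 hψ1]
  have hc : Continuous fun s : ℝ => Real.fourierChar (-⟪s, ξ⟫_ℝ) :=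
    Real.continuous_fourierChar.comp (by fun_prop)
  refine K.integral_mem_of_isClosed hK ((hc.smul hφ).prodMk (hc.smul hψ)) ?_ fun s => ?_
  · refine HasCompactSupport.intro (hφs.isCompact.union hψs.isCompact) fun s hs => ?_
    rw [mem_union, not_or] at hs
    simp [image_eq_zero_of_notMem_tsupport hs.1, image_eq_zero_of_notMem_tsupport hs.2]
  · exact K.smul_mem (Real.fourierChar (-⟪s, ξ⟫_ℝ) : ℂ) (h s)

theorem continuousLinearMap_fourier {E : Type*} [NormedAddCommGroup E] [InnerProductSpace ℂ E]
    [CompleteSpace E] (T : H →L[ℂ] E) {φ : ℝ → H} (h : Integrable φ) (ξ : ℝ) :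
    𝓕 (fun s => T (φ s)) ξ = T (𝓕 φ ξ) := by
  have := T.integral_comp_comm ((Real.fourierIntegral_convergent_iff ξ).2 h)
  rw [Real.fourier_eq, Real.fourier_eq, ← this]
  congr 1
  ext s
  simp [Circle.smul_def]

theorem fourier_smul_I_smul_deriv {U V : ℝ → H} (hU : ∀ s, HasDerivAt U (V s) s)
    (hV : Continuous V) {a : ℝ → ℂ} (ha : ContDiff ℝ ∞ a) (has : HasCompactSupport a) (ξ : ℝ) :
    𝓕 (fun s => a s • Complex.I • V s) ξ
      = ((-(2 * Real.pi * ξ) : ℝ) : ℂ) • 𝓕 (fun s => a s • U s) ξ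
        + 𝓕 (fun s => (-Complex.I * deriv a s) • U s) ξ := by
  have hUc : Continuous U := continuous_iff_continuousAt.2 fun s => (hU s).continuousAt
  have had : Continuous (deriv a) := ha.continuous_deriv (by simp)
  have hd : ∀ s, HasDerivAt (fun s => a s • U s) (a s • V s + deriv a s • U s) s := fun s =>
    ((ha.differentiable (by simp) s).hasDerivAt).smul (hU s)
  have hde : deriv (fun s => a s • U s) = fun s => a s • V s + deriv a s • U s :=
    funext fun s => (hd s).deriv
  have i1 : Integrable (fun s => a s • U s) :=
    (ha.continuous.smul hUc).integrable_of_hasCompactSupport has.smul_right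
  have i2 : Integrable (fun s => a s • V s) :=
    (ha.continuous.smul hV).integrable_of_hasCompactSupport has.smul_right
  have i3 : Integrable (fun s => deriv a s • U s) :=
    (had.smul hUc).integrable_of_hasCompactSupport has.deriv.smul_right
  have key := congrFun (Real.fourier_deriv i1 (fun s => (hd s).differentiableAt)
    (by rw [hde]; exact i2.add i3)) ξ
  have e1 : 𝓕 (fun s => a s • Complex.I • V s) ξ
      = Complex.I • 𝓕 (fun s => a s • V s) ξ := by
    have := continuousLinearMap_fourier (Complex.I • ContinuousLinearMap.id ℂ H) i2 ξ
    simpa [smul_comm Complex.I] using this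
  have e2 : 𝓕 (fun s => (-Complex.I * deriv a s) • U s) ξ
      = -Complex.I • 𝓕 (fun s => deriv a s • U s) ξ := by
    have := continuousLinearMap_fourier (-Complex.I • ContinuousLinearMap.id ℂ H) i3 ξ
    simpa [smul_smul, mul_comm Complex.I] using this
  have e3 : 𝓕 (deriv (fun s => a s • U s)) ξ
      = 𝓕 (fun s => a s • V s) ξ + 𝓕 (fun s => deriv a s • U s) ξ := by
    rw [hde]
    simp only [Real.fourier_eq, smul_add]
    exact integral_add ((Real.fourierIntegral_convergent_iff ξ).2 i2)
      ((Real.fourierIntegral_convergent_iff ξ).2 i3)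
  rw [e3] at key
  rw [e1, e2, eq_sub_of_add_eq key, smul_sub, smul_smul, neg_smul, sub_eq_add_neg]
  congr 2
  push_cast
  linear_combination (2 * Real.pi * ξ : ℂ) * Complex.I_mul_I

variable {S : ℝ → H →L[ℂ] H} {T : H →L[ℂ] H} {K : Submodule ℂ (H × H)}

theorem VirialSystem.lintegral_cutoff_le (h : VirialSystem S T (K : Set (H × H)))
    (hKc : IsClosed (K : Set (H × H))) {U V : ℝ → H} (hU : ∀ s, HasDerivAt U (V s) s)
    (hV : Continuous V) (hK : ∀ s, (U s, Complex.I • V s) ∈ K) {a : ℝ → ℂ}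
    (ha : ContDiff ℝ ∞ a) (has : HasCompactSupport a) {ε : ℝ} (hε : 0 < ε) :
    ∫⁻ s, ‖a s‖ₑ ^ 2 * ‖T (U s)‖ₑ ^ 2 ≤
      2 * (ENNReal.ofReal ε * (∫⁻ s, ‖a s‖ₑ ^ 2)
        + ENNReal.ofReal ε⁻¹ * (∫⁻ s, ‖deriv a s‖ₑ ^ 2)
        + ENNReal.ofReal ε⁻¹ ^ 3 * ∫⁻ s, ‖deriv (deriv a) s‖ₑ ^ 2) * ‖U 0‖ₑ ^ 2 := by
  have hUc : Continuous U := continuous_iff_continuousAt.2 fun s => (hU s).continuousAt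
  have ha' : ContDiff ℝ ∞ (deriv a) := ha.iterate_deriv 1
  set b : ℝ → ℂ := fun s => -Complex.I * deriv a s with hb
  have hbd : ContDiff ℝ ∞ b := contDiff_const.mul ha'
  have hbs : HasCompactSupport b := has.deriv.mul_left
  set e : ℝ → ℂ := fun s => -Complex.I * deriv b s with he
  have hed : ContDiff ℝ ∞ e := contDiff_const.mul (hbd.iterate_deriv 1)
  have hes : HasCompactSupport e := hbs.deriv.mul_left
  have hI : ‖Complex.I‖ₑ = 1 := by rw [← ofReal_norm, Complex.norm_I, ENNReal.ofReal_one]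
  have hbn : ∀ s, ‖b s‖ₑ = ‖deriv a s‖ₑ := fun s => by simp [hb, enorm_mul, hI]
  have hen : ∀ s, ‖e s‖ₑ = ‖deriv (deriv a) s‖ₑ := fun s => by
    simp [he, hb, enorm_mul, hI]
  have hn : ∀ {c : ℝ → ℂ}, ContDiff ℝ ∞ c → HasCompactSupport c →
      ∫⁻ ξ, ‖𝓕 (fun s => c s • U s) ξ‖ₑ ^ 2 = (∫⁻ s, ‖c s‖ₑ ^ 2) * ‖U 0‖ₑ ^ 2 := by
    intro c hc hcs
    rw [lintegral_enorm_fourier_sq (φ := fun s => c s • U s) (hc.continuous.smul hUc)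
      hcs.smul_right,
      ← lintegral_mul_const _ (by have := hc.continuous; fun_prop)]
    refine lintegral_congr fun s => ?_
    rw [enorm_smul, mul_pow]
    congr 2
    rw [← ofReal_norm, ← ofReal_norm, h.norm_eq hU hK s]
  have hm : ∀ {c : ℝ → ℂ}, ContDiff ℝ ∞ c → HasCompactSupport c →
      Measurable fun ξ => ‖𝓕 (fun s => c s • U s) ξ‖ₑ ^ 2 := by
    intro c hc hcs
    have : Continuous (𝓕 (fun s => c s • U s)) :=
      VectorFourier.fourierIntegral_continuous Real.continuous_fourierChar
        (by exact continuous_inner)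
        ((hc.continuous.smul hUc).integrable_of_hasCompactSupport hcs.smul_right)
    exact this.enorm.measurable.pow_const 2
  have i1 : Integrable fun s => a s • U s :=
    (ha.continuous.smul hUc).integrable_of_hasCompactSupport has.smul_right
  have hL : ∫⁻ s, ‖a s‖ₑ ^ 2 * ‖T (U s)‖ₑ ^ 2
      = ∫⁻ ξ, ‖T (𝓕 (fun s => a s • U s) ξ)‖ₑ ^ 2 := by
    have h1 := lintegral_enorm_fourier_sq (φ := fun s => T (a s • U s))
      (T.continuous.comp (ha.continuous.smul hUc))
      ((has.smul_right (f' := U)).comp_left (g := T) (map_zero T))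
    simp_rw [continuousLinearMap_fourier T i1] at h1
    rw [h1]
    refine lintegral_congr fun s => ?_
    rw [map_smul, enorm_smul, mul_pow]
  have hmem : ∀ {c : ℝ → ℂ}, ContDiff ℝ ∞ c → HasCompactSupport c → ∀ ξ,
      (𝓕 (fun s => c s • U s) ξ, 𝓕 (fun s => c s • Complex.I • V s) ξ) ∈ K := by
    intro c hc hcs ξ
    refine fourier_mem_of_isClosed K hKc (hc.continuous.smul hUc) hcs.smul_right
      (hc.continuous.smul (hV.const_smul _)) hcs.smul_right (fun s => ?_) ξ
    exact K.smul_mem (c s) (hK s)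
  have hpt : ∀ ξ, ‖T (𝓕 (fun s => a s • U s) ξ)‖ₑ ^ 2 ≤
      2 * (ENNReal.ofReal ε * ‖𝓕 (fun s => a s • U s) ξ‖ₑ ^ 2
        + ENNReal.ofReal ε⁻¹ * ‖𝓕 (fun s => b s • U s) ξ‖ₑ ^ 2
        + ENNReal.ofReal ε⁻¹ ^ 3 * ‖𝓕 (fun s => e s • U s) ξ‖ₑ ^ 2) := by
    intro ξ
    have := h.norm_sq_le_of_eq (hmem ha has ξ) (hmem hbd hbs ξ) hε
      (fourier_smul_I_smul_deriv hU hV ha has ξ) (fourier_smul_I_smul_deriv hU hV hbd hbs ξ)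
    have := ENNReal.ofReal_le_ofReal this
    have hε' := inv_nonneg.2 hε.le
    rw [ENNReal.ofReal_mul (by norm_num), ENNReal.ofReal_add (by positivity) (by positivity),
      ENNReal.ofReal_add (by positivity) (by positivity), ENNReal.ofReal_mul (by positivity),
      ENNReal.ofReal_mul (by positivity), ENNReal.ofReal_mul (by positivity)] at this
    simpa only [ENNReal.ofReal_ofNat, ENNReal.ofReal_pow, norm_nonneg, hε', ofReal_norm] using this
  rw [hL]
  refine (lintegral_mono hpt).trans_eq ?_
  rw [lintegral_const_mul _
      (by have := hm ha has; have := hm hbd hbs; have := hm hed hes; fun_prop),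
    lintegral_add_right _ ((hm hed hes).const_mul _),
    lintegral_add_right _ ((hm hbd hbs).const_mul _), lintegral_const_mul _ (hm ha has),
    lintegral_const_mul _ (hm hbd hbs), lintegral_const_mul _ (hm hed hes), hn ha has, hn hbd hbs,
    hn hed hes]
  simp_rw [hbn, hen]
  ring

theorem lintegral_comp_mul_left_real (f : ℝ → ℝ≥0∞) (hf : Measurable f) {ε : ℝ} (hε : 0 < ε) :
    ∫⁻ s, f (ε * s) = ENNReal.ofReal ε⁻¹ * ∫⁻ s, f s := by
  have h := Real.map_volume_mul_left hε.ne'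
  rw [← lintegral_map hf (measurable_const_mul ε), h, lintegral_smul_measure,
    abs_of_pos (inv_pos.2 hε), smul_eq_mul]

/-- A universal constant for the smoothing estimate, in terms of a smooth cutoff. -/
theorem exists_cutoff : ∃ χ : ℝ → ℂ, ContDiff ℝ ∞ χ ∧ HasCompactSupport χ ∧
    ∀ s, |s| ≤ 1 → χ s = 1 := by
  let f : ContDiffBump (0 : ℝ) := ⟨1, 2, one_pos, one_lt_two⟩
  refine ⟨fun s => (f s : ℂ), Complex.ofRealCLM.contDiff.comp f.contDiff,
    f.hasCompactSupport.comp_left (g := ((↑) : ℝ → ℂ)) rfl, fun s hs => ?_⟩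
  change (f s : ℂ) = 1
  rw [f.one_of_mem_closedBall (by simpa using hs), Complex.ofReal_one]

theorem exists_virial_constant : ∃ C : ℝ, 0 < C ∧
    ∀ {H : Type} [NormedAddCommGroup H] [InnerProductSpace ℂ H] [CompleteSpace H]
      {S : ℝ → H →L[ℂ] H} {T : H →L[ℂ] H} {K : Submodule ℂ (H × H)},
      VirialSystem S T (K : Set (H × H)) → IsClosed (K : Set (H × H)) →
      ∀ {U V : ℝ → H}, (∀ s, HasDerivAt U (V s) s) → Continuous V →
      (∀ s, (U s, Complex.I • V s) ∈ K) →
      ∫⁻ s, ‖T (U s)‖ₑ ^ 2 ≤ ENNReal.ofReal C * ‖U 0‖ₑ ^ 2 := by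
  obtain ⟨χ, hχ, hχs, hχ1⟩ := exists_cutoff
  have hχ' : ContDiff ℝ ∞ (deriv χ) := hχ.iterate_deriv 1
  have hχ'' : ContDiff ℝ ∞ (deriv (deriv χ)) := hχ.iterate_deriv 2
  set A : ℝ≥0∞ := 2 * ((∫⁻ s, ‖χ s‖ₑ ^ 2) + (∫⁻ s, ‖deriv χ s‖ₑ ^ 2)
    + ∫⁻ s, ‖deriv (deriv χ) s‖ₑ ^ 2) with hA
  have hfin : ∀ {c : ℝ → ℂ}, Continuous c → HasCompactSupport c → ∫⁻ s, ‖c s‖ₑ ^ 2 ≠ ⊤ := by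
    intro c hc hcs
    have := (hc.mul hc).integrable_of_hasCompactSupport (μ := volume) hcs.mul_left
    simpa [enorm_mul, sq, HasFiniteIntegral] using this.2.ne
  have hAt : A ≠ ⊤ := ENNReal.mul_ne_top (by simp) (ENNReal.add_ne_top.2 ⟨ENNReal.add_ne_top.2
    ⟨hfin hχ.continuous hχs, hfin hχ'.continuous hχs.deriv⟩,
      hfin hχ''.continuous hχs.deriv.deriv⟩)
  refine ⟨A.toReal + 1, by positivity, ?_⟩
  intro H _ _ _ S T K h hKc U V hU hV hK
  have hUc : Continuous U := continuous_iff_continuousAt.2 fun s => (hU s).continuousAt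
  have hAC : A ≤ ENNReal.ofReal (A.toReal + 1) := by
    conv_lhs => rw [← ENNReal.ofReal_toReal hAt]
    exact ENNReal.ofReal_le_ofReal (by linarith)
  refine le_trans ?_ (mul_le_mul_left hAC _)
  have step : ∀ ε : ℝ, 0 < ε → ∫⁻ s in {s | |ε * s| ≤ 1}, ‖T (U s)‖ₑ ^ 2 ≤ A * ‖U 0‖ₑ ^ 2 := by
    intro ε hε
    have d1 : deriv (fun s => χ (ε * s)) = fun s => ε • deriv χ (ε * s) :=
      funext fun s => deriv_comp_mul_left ε χ s
    have d2 : deriv (deriv (fun s => χ (ε * s))) = fun s => ε • ε • deriv (deriv χ) (ε * s) := by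
      rw [d1]
      funext s
      rw [deriv_fun_const_smul_field, deriv_comp_mul_left ε (deriv χ) s]
    have hs : HasCompactSupport (fun s => χ (ε * s)) :=
      hχs.comp_homeomorph (Homeomorph.mulLeft₀ ε hε.ne')
    have main := h.lintegral_cutoff_le hKc hU hV hK
      (a := fun s => χ (ε * s)) (hχ.comp (contDiff_const.mul contDiff_id)) hs hε
    rw [d2, d1] at main
    have m0 := hχ.continuous
    have m1 := hχ'.continuous
    have m2 := hχ''.continuous
    have hεe : ‖ε‖ₑ = ENNReal.ofReal ε := Real.enorm_of_nonneg hε.le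
    have c1 : ENNReal.ofReal ε * ENNReal.ofReal ε⁻¹ = 1 := by
      rw [← ENNReal.ofReal_mul hε.le, mul_inv_cancel₀ hε.ne', ENNReal.ofReal_one]
    have s0 := lintegral_comp_mul_left_real (fun s => ‖χ s‖ₑ ^ 2) (by fun_prop) hε
    have s1 := lintegral_comp_mul_left_real (fun s => ‖deriv χ s‖ₑ ^ 2) (by fun_prop) hε
    have s2 := lintegral_comp_mul_left_real (fun s => ‖deriv (deriv χ) s‖ₑ ^ 2) (by fun_prop) hε
    simp only [enorm_smul, mul_pow, hεe] at main
    rw [lintegral_const_mul _ (by fun_prop), lintegral_const_mul _ (by fun_prop),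
      lintegral_const_mul _ (by fun_prop)] at main
    rw [s0, s1, s2] at main
    refine le_trans ?_ (main.trans_eq ?_)
    · rw [← lintegral_indicator (measurableSet_le (by fun_prop) measurable_const)]
      refine lintegral_mono fun s => ?_
      revert s
      refine indicator_le fun s hs => ?_
      rw [hχ1 _ hs]
      simp
    · rw [hA]
      congr 2
      set x := ENNReal.ofReal ε
      set y := ENNReal.ofReal ε⁻¹
      have e2 : y * (x ^ 2 * (y * ∫⁻ s, ‖deriv χ s‖ₑ ^ 2)) = ∫⁻ s, ‖deriv χ s‖ₑ ^ 2 := by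
        calc _ = (x * y) ^ 2 * ∫⁻ s, ‖deriv χ s‖ₑ ^ 2 := by ring
          _ = _ := by rw [c1]; simp
      have e3 : y ^ 3 * (x ^ 2 * (x ^ 2 * (y * ∫⁻ s, ‖deriv (deriv χ) s‖ₑ ^ 2)))
          = ∫⁻ s, ‖deriv (deriv χ) s‖ₑ ^ 2 := by
        calc _ = (x * y) ^ 4 * ∫⁻ s, ‖deriv (deriv χ) s‖ₑ ^ 2 := by ring
          _ = _ := by rw [c1]; simp
      rw [← mul_assoc, c1, one_mul, e2, e3]
  have hun : (⋃ n : ℕ, {s : ℝ | |((n : ℝ) + 1)⁻¹ * s| ≤ 1}) = univ := by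
    refine eq_univ_of_forall fun s => mem_iUnion.2 ?_
    obtain ⟨n, hn⟩ := exists_nat_ge |s|
    refine ⟨n, ?_⟩
    have : (0 : ℝ) < (n : ℝ) + 1 := by positivity
    simp only [mem_ofPred_eq]
    rw [abs_mul, abs_of_pos (inv_pos.2 this), inv_mul_le_one₀ this]
    linarith
  rw [← setLIntegral_univ, ← hun, setLIntegral_iUnion_of_directed]
  · exact iSup_le fun n => step _ (by positivity)
  · refine Monotone.directed_le fun n m hnm s hs => ?_
    simp only [mem_ofPred_eq, abs_mul] at hs ⊢
    refine le_trans ?_ hs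
    have : (n : ℝ) ≤ m := by exact_mod_cast hnm
    have h0 : (0 : ℝ) < (n : ℝ) + 1 := by positivity
    have hm0 : (0 : ℝ) < (m : ℝ) + 1 := by positivity
    rw [abs_of_pos (inv_pos.2 h0), abs_of_pos (inv_pos.2 hm0)]
    gcongr
end

theorem integrableOn_Ioi_of_norm_le_div_sq {φ : ℝ → ℂ} (hφ : Continuous φ) {C : ℝ}
    (h : ∀ r, 1 ≤ r → ‖φ r‖ ≤ C / r ^ 2) : IntegrableOn φ (Ioi 1) := by
  have h1 : IntegrableOn (fun r : ℝ => C * r ^ (-2 : ℝ)) (Ioi 1) :=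
    (integrableOn_Ioi_rpow_of_lt (by norm_num) one_pos).const_mul C
  refine h1.mono' hφ.aestronglyMeasurable.restrict ((ae_restrict_mem measurableSet_Ioi).mono ?_)
  intro r hr
  have hr : (1 : ℝ) < r := hr
  have h0 : 0 < r := by linarith
  refine (h r hr.le).trans_eq ?_
  rw [Real.rpow_neg h0.le, div_eq_mul_inv]
  norm_cast

theorem norm_sq_integral_Ioi_eq {φ : ℝ → ℂ} (hφ : Continuous φ) {C : ℝ}
    (h : ∀ r, 1 ≤ r → ‖φ r‖ ≤ C / r ^ 2) :
    ‖∫ r in Ioi (1 : ℝ), φ r‖ ^ 2 =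
      2 * (∫ r in Ioi (1 : ℝ), ∫ ρ in Ioi (1 : ℝ), (r : ℂ) * conj (φ r) * φ (ρ * r)).re := by
  have hint := integrableOn_Ioi_of_norm_le_div_sq hφ h
  have hC : 0 ≤ C := by simpa using (norm_nonneg _).trans (h 1 le_rfl)
  set I := ∫ r in Ioi (1 : ℝ), φ r with hI
  set Γ : ℝ → ℂ := fun r => I - ∫ q in (1 : ℝ)..r, φ q with hΓ
  have hΓd : ∀ r, HasDerivAt Γ (-φ r) r := fun r => by
    simpa using (intervalIntegral.integral_hasDerivAt_right (hφ.intervalIntegrable _ _)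
      (hφ.stronglyMeasurableAtFilter _ _) hφ.continuousAt).const_sub I
  have hΓt : Tendsto Γ atTop (𝓝 0) := by
    have := (intervalIntegral_tendsto_integral_Ioi 1 hint tendsto_id).const_sub I
    simpa [← hI] using this
  have hΓe : ∀ r, 1 ≤ r → Γ r = ∫ q in Ioi r, φ q := fun r hr => by
    have := intervalIntegral.integral_Ioi_sub_Ioi hint hr
    simp only [hΓ, ← hI] at this ⊢
    rw [← this]; ring
  have hΓc : Continuous Γ := continuous_iff_continuousAt.2 fun r => (hΓd r).continuousAt
  have hΓb : ∀ r, 1 ≤ r → ‖Γ r‖ ≤ ∫ q in Ioi (1 : ℝ), ‖φ q‖ := fun r hr => by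
    rw [hΓe r hr]
    refine (norm_integral_le_integral_norm _).trans (setIntegral_mono_set hint.norm
      (ae_of_all _ fun _ => norm_nonneg _) (Ioi_subset_Ioi hr).eventuallyLE)
  have key : ∀ r, HasDerivAt (fun r => ‖Γ r‖ ^ 2) (-2 * (conj (φ r) * Γ r).re) r := fun r => by
    have := (hΓd r).norm_sq
    refine this.congr_deriv ?_
    rw [Complex.inner]
    simp
    ring
  have hint2 : IntegrableOn (fun r => conj (φ r) * Γ r) (Ioi 1) := by
    refine Integrable.mul_of_top_left ?_ ?_ 
    · exact Complex.conjLIE.integrable_comp_iff.2 hint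
    · refine memLp_top_of_bound hΓc.aestronglyMeasurable.restrict _
        ((ae_restrict_mem measurableSet_Ioi).mono fun r hr => hΓb r (le_of_lt hr))
  have e1 := integral_Ioi_of_hasDerivAt_of_tendsto' (a := (1:ℝ)) (fun r _ => key r)
    (hint2.re.const_mul (-2)) (by simpa using (hΓt.norm.pow 2))
  have hΓ1 : Γ 1 = I := by simp [hΓ]
  have e2 : ∫ r in Ioi (1 : ℝ), conj (φ r) * Γ r =
      ∫ r in Ioi (1 : ℝ), ∫ ρ in Ioi (1 : ℝ), (r : ℂ) * conj (φ r) * φ (ρ * r) := by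
    refine setIntegral_congr_fun measurableSet_Ioi fun r hr => ?_
    have hr : (1 : ℝ) < r := hr
    have h0 : 0 < r := by linarith
    have := integral_comp_mul_right_Ioi φ 1 h0
    rw [integral_const_mul, this, one_mul, ← hΓe r hr.le, Complex.real_smul]
    push_cast
    have : (r : ℂ) ≠ 0 := by exact_mod_cast h0.ne'
    field_simp
  have e3 : ∫ r in Ioi (1 : ℝ), (conj (φ r) * Γ r).re =
      (∫ r in Ioi (1 : ℝ), conj (φ r) * Γ r).re := integral_re hint2
  rw [← e2, ← e3]
  rw [hΓ1, integral_const_mul] at e1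
  linarith

section
variable {α : Type*} [MeasurableSpace α] {μ : Measure α}

/-- The bounded operator on `L²` induced by a linear operation on functions. -/
def lpOp (A : (α → ℂ) → α → ℂ) (C : ℝ) (hadd : ∀ f g, A (f + g) = A f + A g)
    (hsmul : ∀ (c : ℂ) f, A (c • f) = c • A f)
    (hae : ∀ f g, f =ᵐ[μ] g → A f =ᵐ[μ] A g)
    (hm : ∀ f, AEStronglyMeasurable f μ → AEStronglyMeasurable (A f) μ)
    (hC : ∀ f, AEStronglyMeasurable f μ → eLpNorm (A f) 2 μ ≤ ENNReal.ofReal C * eLpNorm f 2 μ) :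
    Lp ℂ 2 μ →L[ℂ] Lp ℂ 2 μ :=
  have hmem : ∀ f : Lp ℂ 2 μ, MemLp (A f) 2 μ := fun f =>
    ⟨hm _ (Lp.aestronglyMeasurable f), (hC _ (Lp.aestronglyMeasurable f)).trans_lt
      (ENNReal.mul_lt_top ENNReal.ofReal_lt_top (Lp.eLpNorm_lt_top f))⟩
  LinearMap.mkContinuous
    { toFun := fun f => (hmem f).toLp
      map_add' := fun f g => by
        rw [← MemLp.toLp_add]
        exact MemLp.toLp_congr _ _ ((hae _ _ (Lp.coeFn_add f g)).trans (by rw [hadd]))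
      map_smul' := fun c f => by
        rw [RingHom.id_apply, ← MemLp.toLp_const_smul]
        exact MemLp.toLp_congr _ _ ((hae _ _ (Lp.coeFn_smul c f)).trans (by rw [hsmul])) }
    (max C 0) fun f => by
      simp only [LinearMap.coe_mk, AddHom.coe_mk, Lp.norm_def]
      rw [← ENNReal.toReal_ofReal (le_max_right C 0), ← ENNReal.toReal_mul]
      refine ENNReal.toReal_mono (ENNReal.mul_ne_top ENNReal.ofReal_ne_top (Lp.eLpNorm_ne_top f))
        ((eLpNorm_congr_ae (MemLp.coeFn_toLp (hmem f))).trans_le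
          ((hC _ (Lp.aestronglyMeasurable f)).trans ?_))
      gcongr
      exact le_max_left _ _

theorem lpOp_coeFn {A : (α → ℂ) → α → ℂ} {C : ℝ} (hadd : ∀ f g, A (f + g) = A f + A g)
    (hsmul : ∀ (c : ℂ) f, A (c • f) = c • A f)
    (hae : ∀ f g, f =ᵐ[μ] g → A f =ᵐ[μ] A g)
    (hm : ∀ f, AEStronglyMeasurable f μ → AEStronglyMeasurable (A f) μ)
    (hC : ∀ f, AEStronglyMeasurable f μ → eLpNorm (A f) 2 μ ≤ ENNReal.ofReal C * eLpNorm f 2 μ)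
    (f : Lp ℂ 2 μ) : lpOp A C hadd hsmul hae hm hC f =ᵐ[μ] A f :=
  MemLp.coeFn_toLp (f := A f) ⟨hm _ (Lp.aestronglyMeasurable f),
    (hC _ (Lp.aestronglyMeasurable f)).trans_lt
      (ENNReal.mul_lt_top ENNReal.ofReal_lt_top (Lp.eLpNorm_lt_top f))⟩

end

/-- The parabolic dilation `(z, t) ↦ (r z, r² t)`. -/
def dil (d : ℕ) (r : ℝ) (p : Hd d) : Hd d := (r • p.1, r • p.2.1, r ^ 2 * p.2.2)

/-- The parabolic dilation as a continuous linear equivalence. -/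
def dilEquiv (d : ℕ) {r : ℝ} (hr : r ≠ 0) : Hd d ≃L[ℝ] Hd d :=
  (ContinuousLinearEquiv.smulLeft (Units.mk0 r hr)).prodCongr
    ((ContinuousLinearEquiv.smulLeft (Units.mk0 r hr)).prodCongr
      (ContinuousLinearEquiv.smulLeft (Units.mk0 (r ^ 2) (pow_ne_zero 2 hr))))

theorem dilEquiv_apply {d : ℕ} {r : ℝ} (hr : r ≠ 0) (p : Hd d) : dilEquiv d hr p = dil d r p := rfl

theorem continuous_uncurry_dil (d : ℕ) : Continuous fun q : ℝ × Hd d => dil d q.1 q.2 := by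
  unfold dil; fun_prop

theorem dil_dil {d : ℕ} (r s : ℝ) (p : Hd d) : dil d r (dil d s p) = dil d (r * s) p := by
  simp [dil, smul_smul, mul_pow, mul_assoc]

theorem map_dil (d : ℕ) {r : ℝ} (hr : 0 < r) :
    (volume : Measure (Hd d)).map (dil d r) = ENNReal.ofReal ((r ^ (2 * d + 2))⁻¹) • volume := by
  have e : dil d r = Prod.map (r • ·) (Prod.map (r • ·) (r ^ 2 • ·)) := rfl
  rw [e, Measure.volume_eq_prod, ← Measure.map_prod_map, Measure.volume_eq_prod,
    ← Measure.map_prod_map,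
    Measure.map_addHaar_smul _ hr.ne', Measure.map_addHaar_smul _ (pow_ne_zero 2 hr.ne'),
    Measure.prod_smul_left, Measure.prod_smul_right, Measure.prod_smul_left,
    Measure.prod_smul_right, Measure.prod_smul_right, smul_smul, smul_smul]
  · congr 1
    rw [abs_of_pos (by positivity), abs_of_pos (by positivity),
      ← ENNReal.ofReal_mul (by positivity),
      ← ENNReal.ofReal_mul (by positivity)]
    congr 1
    simp
    field_simp
    ring
  all_goals fun_prop

theorem continuous_dil (d : ℕ) (r : ℝ) : Continuous (dil d r) := by unfold dil; fun_prop

theorem quasiMeasurePreserving_dil (d : ℕ) {r : ℝ} (hr : 0 < r) :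
    Measure.QuasiMeasurePreserving (dil d r) (volume : Measure (Hd d)) volume :=
  ⟨(continuous_dil d r).measurable, by rw [map_dil d hr]; exact Measure.smul_absolutelyContinuous⟩

theorem eLpNorm_comp_dil {d : ℕ} {r : ℝ} (hr : 0 < r) {f : Hd d → ℂ}
    (hf : AEStronglyMeasurable f volume) :
    eLpNorm (f ∘ dil d r) 2 volume = ENNReal.ofReal ((r ^ (d + 1))⁻¹) * eLpNorm f 2 volume := by
  rw [← eLpNorm_map_measure _ (continuous_dil d r).aemeasurable, map_dil d hr,
    eLpNorm_smul_measure_of_ne_top (by norm_num), smul_eq_mul]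
  · congr 1
    rw [ENNReal.ofReal_rpow_of_pos (by positivity)]
    congr 1
    rw [show 2 * d + 2 = (d + 1) * 2 by ring, pow_mul, ← inv_pow, ← Real.rpow_natCast,
      ← Real.rpow_mul (by positivity)]
    simp
  · rw [map_dil d hr]
    exact hf.smul_measure _

/-- The dilation operator `f ↦ f ∘ δ_r` on `L²`, with `r = max ρ 1`. -/
def dilOp (d : ℕ) (ρ : ℝ) :
    Lp ℂ 2 (volume : Measure (Hd d)) →L[ℂ] Lp ℂ 2 (volume : Measure (Hd d)) :=
  have h0 : 0 < max ρ 1 := lt_max_of_lt_right one_pos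
  lpOp (fun f => f ∘ dil d (max ρ 1)) ((max ρ 1 ^ (d + 1))⁻¹) (fun _ _ => rfl) (fun _ _ => rfl)
    (fun _ _ h => (quasiMeasurePreserving_dil d h0).ae_eq_comp h)
    (fun _ h => h.comp_quasiMeasurePreserving (quasiMeasurePreserving_dil d h0))
    (fun _ h => (eLpNorm_comp_dil h0 h).le)

theorem dilOp_coeFn (d : ℕ) {ρ : ℝ} (hρ : 1 ≤ ρ) (f : Lp ℂ 2 (volume : Measure (Hd d))) :
    dilOp d ρ f =ᵐ[volume] fun p => f (dil d ρ p) := by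
  have h : dilOp d ρ f =ᵐ[volume] f ∘ dil d (max ρ 1) := lpOp_coeFn _ _ _ _ _ f
  rwa [max_eq_left hρ] at h

theorem norm_dilOp {d : ℕ} {ρ : ℝ} (hρ : 1 ≤ ρ) (f : Lp ℂ 2 (volume : Measure (Hd d))) :
    ‖dilOp d ρ f‖ = (ρ ^ (d + 1))⁻¹ * ‖f‖ := by
  have h0 : 0 < ρ := by linarith
  rw [Lp.norm_def, Lp.norm_def, eLpNorm_congr_ae (dilOp_coeFn d hρ f)]
  have := eLpNorm_comp_dil h0 (Lp.aestronglyMeasurable f)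
  change (eLpNorm (f ∘ dil d ρ) 2 volume).toReal = _
  rw [this, ENNReal.toReal_mul, ENNReal.toReal_ofReal (by positivity)]

theorem sq_mul_norm_dilOp_le {d : ℕ} (hd : 1 ≤ d) {ρ : ℝ} (hρ : 1 ≤ ρ)
    (f : Lp ℂ 2 (volume : Measure (Hd d))) : ρ ^ 2 * ‖dilOp d ρ f‖ ≤ ‖f‖ := by
  have h0 : 0 < ρ := by linarith
  rw [norm_dilOp hρ, ← mul_assoc, ← div_eq_mul_inv]
  refine mul_le_of_le_one_left (norm_nonneg _) ?_
  rw [div_le_one (by positivity)]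
  exact pow_le_pow_right₀ hρ (by omega)

theorem aestronglyMeasurable_inner_dilOp {d : ℕ} (g l : Lp ℂ 2 (volume : Measure (Hd d))) :
    AEStronglyMeasurable (fun ρ => ⟪g, dilOp d ρ l⟫_ℂ) (volume.restrict (Ioi 1)) := by
  have hl := Lp.stronglyMeasurable l
  have hg := Lp.stronglyMeasurable g
  have h1 : StronglyMeasurable fun ρ : ℝ => ∫ p, ⟪g p, l (dil d ρ p)⟫_ℂ := by
    refine StronglyMeasurable.integral_prod_right' (f := fun q : ℝ × Hd d =>
      ⟪g q.2, l (dil d q.1 q.2)⟫_ℂ) ?_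
    exact (hg.comp_measurable measurable_snd).inner
      (hl.comp_measurable (continuous_uncurry_dil d).measurable)
  refine h1.aestronglyMeasurable.congr ((ae_restrict_mem measurableSet_Ioi).mono fun ρ hρ => ?_)
  refine (integral_congr_ae ?_).trans (L2.inner_def _ _).symm
  filter_upwards [dilOp_coeFn d (le_of_lt hρ) l] with p hp
  rw [hp]

/-- Multiplication by a bounded measurable function on `L²`. -/
def mulOp {α : Type*} [MeasurableSpace α] {μ : Measure α} {m : α → ℝ} {C : ℝ} (hm : Measurable m)
    (hC : ∀ x, ‖m x‖ ≤ C) : Lp ℂ 2 μ →L[ℂ] Lp ℂ 2 μ :=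
  lpOp (fun f x => m x * f x) C (fun f g => by ext x; simp [mul_add])
    (fun c f => by ext x; simp; ring)
    (fun f g h => h.mono fun x hx => by simp only [hx])
    (fun f hf => (Complex.measurable_ofReal.comp hm).aestronglyMeasurable.mul hf)
    (fun f hf => eLpNorm_le_mul_eLpNorm_of_ae_le_mul (ae_of_all _ fun x => by
      rw [norm_mul, Complex.norm_real]
      exact mul_le_mul_of_nonneg_right (hC x) (norm_nonneg _)) 2)

theorem mulOp_coeFn {α : Type*} [MeasurableSpace α] {μ : Measure α} {m : α → ℝ} {C : ℝ}
    (hm : Measurable m) (hC : ∀ x, ‖m x‖ ≤ C) (f : Lp ℂ 2 μ) :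
    mulOp hm hC f =ᵐ[μ] fun x => m x * f x :=
  lpOp_coeFn _ _ _ _ _ f

instance instIsAddHaarMeasureHd (d : ℕ) : (volume : Measure (Hd d)).IsAddHaarMeasure :=
  have : (volume : Measure (EuclideanSpace ℝ (Fin d) × ℝ)).IsAddHaarMeasure :=
    inferInstanceAs (Measure.IsAddHaarMeasure
      ((volume : Measure (EuclideanSpace ℝ (Fin d))).prod (volume : Measure ℝ)))
  Measure.prod.instIsAddHaarMeasure _ _

theorem inner_toLp_toLp {d : ℕ} (f g : 𝓢(Hd d, ℂ)) :
    ⟪f.toLp 2 volume, g.toLp 2 volume⟫_ℂ = ∫ p, ⟪f p, g p⟫_ℂ := by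
  refine (L2.inner_def _ _).trans (integral_congr_ae ?_)
  filter_upwards [f.coeFn_toLp 2 volume, g.coeFn_toLp 2 volume] with p hf hg
  rw [hf, hg]

/-- The vector field `∂_a + c ∂_t` acting on Schwartz functions. -/
def vectorField (d : ℕ) (a : Hd d) (c : Hd d →L[ℝ] ℝ) : 𝓢(Hd d, ℂ) →L[ℂ] 𝓢(Hd d, ℂ) :=
  LineDeriv.lineDerivOpCLM ℂ 𝓢(Hd d, ℂ) a + (SchwartzMap.smulLeftCLM ℂ fun p => (c p : ℂ)) ∘L
    LineDeriv.lineDerivOpCLM ℂ 𝓢(Hd d, ℂ) ((0, 0, 1) : Hd d)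

theorem ContinuousLinearMap.hasTemperateGrowth_ofReal {E : Type*} [NormedAddCommGroup E]
    [NormedSpace ℝ E] (c : E →L[ℝ] ℝ) : (fun p => (c p : ℂ)).HasTemperateGrowth :=
  (Complex.ofRealCLM.comp c).hasTemperateGrowth

theorem vectorField_apply_eq_add {d : ℕ} (a : Hd d) (c : Hd d →L[ℝ] ℝ) (u : 𝓢(Hd d, ℂ))
    (p : Hd d) : vectorField d a c u p = ∂_{a} u p + c p * ∂_{((0, 0, 1) : Hd d)} u p := by
  simp only [vectorField, add_apply, ContinuousLinearMap.comp_apply,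
    LineDeriv.lineDerivOpCLM_apply]
  rw [SchwartzMap.smulLeftCLM_apply_apply c.hasTemperateGrowth_ofReal, smul_eq_mul]

theorem vectorField_apply {d : ℕ} (a : Hd d) (c : Hd d →L[ℝ] ℝ) (u : 𝓢(Hd d, ℂ))
    (p : Hd d) : vectorField d a c u p = fderiv ℝ u p (a + (0, 0, c p)) := by
  rw [vectorField_apply_eq_add, SchwartzMap.lineDerivOp_apply_eq_fderiv,
    SchwartzMap.lineDerivOp_apply_eq_fderiv, map_add]
  congr 1
  have : ((0, 0, c p) : Hd d) = c p • ((0, 0, 1) : Hd d) := by simp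
  rw [this, map_smul, Complex.real_smul]

theorem inner_lineDerivOp_right {d : ℕ} (v : Hd d) (f g : 𝓢(Hd d, ℂ)) :
    ∫ p, ⟪f p, (∂_{v} g) p⟫_ℂ = -∫ p, ⟪(∂_{v} f) p, g p⟫_ℂ := by
  have := SchwartzMap.integral_bilinear_lineDerivOp_right_eq_neg_left (μ := volume) f g
    ((ContinuousLinearMap.mul ℝ ℂ).comp (Complex.conjCLE : ℂ →L[ℝ] ℂ)) v
  simpa [mul_comm] using this

theorem inner_vectorField_right {d : ℕ} (a : Hd d) {c : Hd d →L[ℝ] ℝ} (hc : c (0, 0, 1) = 0)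
    (f g : 𝓢(Hd d, ℂ)) : ⟪f.toLp 2 volume, (vectorField d a c g).toLp 2 volume⟫_ℂ =
      -⟪(vectorField d a c f).toLp 2 volume, g.toLp 2 volume⟫_ℂ := by
  set e : Hd d := (0, 0, 1) with he
  set m : 𝓢(Hd d, ℂ) →L[ℂ] 𝓢(Hd d, ℂ) := SchwartzMap.smulLeftCLM ℂ fun p => (c p : ℂ) with hm
  have hma : ∀ h p, m h p = c p * h p := fun h p => by
    rw [hm, SchwartzMap.smulLeftCLM_apply_apply c.hasTemperateGrowth_ofReal, smul_eq_mul]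
  have hsplit : ∀ h, vectorField d a c h = ∂_{a} h + m (∂_{e} h) := fun h => rfl
  have hcomm : ∂_{e} (m f) = m (∂_{e} f) := by
    ext p
    rw [hma, SchwartzMap.lineDerivOp_apply_eq_fderiv, SchwartzMap.lineDerivOp_apply_eq_fderiv]
    have h1 : HasFDerivAt (fun p => (c p : ℂ)) (Complex.ofRealCLM.comp c) p :=
      (Complex.ofRealCLM.comp c).hasFDerivAt
    have h2 : HasFDerivAt f (fderiv ℝ f p) p := f.differentiableAt.hasFDerivAt
    have h3 : (m f : Hd d → ℂ) = fun p => (c p : ℂ) * f p := funext (hma f)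
    rw [h3, (h1.fun_mul h2).fderiv]
    simp [hc]
  have ilp : ∀ h k : 𝓢(Hd d, ℂ), ∀ k', (SchwartzMap.toLp (h + k) 2 volume) = k' →
    h.toLp 2 volume + k.toLp 2 volume = k' := fun h k k' hk => hk ▸ rfl
  rw [hsplit, hsplit, ← ilp _ _ _ rfl, ← ilp _ _ _ rfl, inner_add_right, inner_add_left,
    neg_add]
  congr 1
  · rw [inner_toLp_toLp, inner_toLp_toLp]
    exact inner_lineDerivOp_right a f g
  · rw [inner_toLp_toLp, inner_toLp_toLp, ← hcomm,
      ← inner_lineDerivOp_right e (m f) g]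
    congr 1; ext p
    simp only [hma, RCLike.inner_apply, map_mul, Complex.conj_ofReal]
    ring

/-- Composition of a Schwartz function with a parabolic dilation. -/
def schwartzDil (d : ℕ) {r : ℝ} (hr : r ≠ 0) : 𝓢(Hd d, ℂ) →L[ℂ] 𝓢(Hd d, ℂ) :=
  SchwartzMap.compCLMOfContinuousLinearEquiv ℂ (dilEquiv d hr)

theorem schwartzDil_apply {d : ℕ} {r : ℝ} (hr : r ≠ 0) (u : 𝓢(Hd d, ℂ)) (p : Hd d) :
    schwartzDil d hr u p = u (dil d r p) := rfl

theorem dilOp_toLp {d : ℕ} {ρ : ℝ} (hρ : 1 ≤ ρ) (u : 𝓢(Hd d, ℂ)) :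
    dilOp d ρ (u.toLp 2 volume) =
      (schwartzDil d (one_pos.trans_le hρ).ne' u).toLp 2 volume := by
  refine Lp.ext ((dilOp_coeFn d hρ _).trans (EventuallyEq.trans ?_
    (SchwartzMap.coeFn_toLp _ _ _).symm))
  exact (quasiMeasurePreserving_dil d (one_pos.trans_le hρ)).ae_eq_comp (u.coeFn_toLp 2 volume)

theorem vectorField_schwartzDil {d : ℕ} {a : Hd d} {c : Hd d →L[ℝ] ℝ}
    (ha : ∀ r, dil d r a = r • a) (hc : ∀ r p, c (dil d r p) = r * c p) {r : ℝ} (hr : r ≠ 0)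
    (u : 𝓢(Hd d, ℂ)) :
    vectorField d a c (schwartzDil d hr u) = (r : ℂ) • schwartzDil d hr (vectorField d a c u) := by
  ext p
  rw [smul_apply, schwartzDil_apply, vectorField_apply, vectorField_apply]
  have h1 : HasFDerivAt (dil d r) (dilEquiv d hr : Hd d →L[ℝ] Hd d) p :=
    (dilEquiv d hr : Hd d →L[ℝ] Hd d).hasFDerivAt
  have h2 : HasFDerivAt u (fderiv ℝ u (dil d r p)) (dil d r p) := u.differentiableAt.hasFDerivAt
  have h3 : (schwartzDil d hr u : Hd d → ℂ) = u ∘ dil d r := rfl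
  rw [h3, (h2.comp p h1).fderiv, ContinuousLinearMap.comp_apply, ContinuousLinearEquiv.coe_coe,
    map_add, dilEquiv_apply, dilEquiv_apply, ha, hc]
  have : dil d r (0, 0, c p) = r • ((0, 0, r * c p) : Hd d) := by
    simp [dil]; ring
  rw [this, ← smul_add, map_smul, Complex.real_smul, smul_eq_mul]

/-- The constant parts of the fields `X_j` and `Y_j`. -/
def horizontalVec (d : ℕ) : Fin d ⊕ Fin d → Hd d
  | .inl j => (EuclideanSpace.single j 1, 0, 0)
  | .inr j => (0, EuclideanSpace.single j 1, 0)

/-- The coefficients of `∂_t` in the fields `X_j` and `Y_j`. -/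
def horizontalCoeff (d : ℕ) : Fin d ⊕ Fin d → Hd d →L[ℝ] ℝ
  | .inl j => (2 : ℝ) • (EuclideanSpace.proj j ∘L .fst ℝ _ _ ∘L .snd ℝ _ _)
  | .inr j => (-2 : ℝ) • (EuclideanSpace.proj j ∘L .fst ℝ _ _)

/-- The horizontal fields `X_j` and `Y_j` on Schwartz functions. -/
def horizontalField (d : ℕ) (i : Fin d ⊕ Fin d) : 𝓢(Hd d, ℂ) →L[ℂ] 𝓢(Hd d, ℂ) :=
  vectorField d (horizontalVec d i) (horizontalCoeff d i)

theorem dil_horizontalVec {d : ℕ} (i : Fin d ⊕ Fin d) (r : ℝ) :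
    dil d r (horizontalVec d i) = r • horizontalVec d i := by
  cases i <;> simp [dil, horizontalVec]

theorem horizontalCoeff_dil {d : ℕ} (i : Fin d ⊕ Fin d) (r : ℝ) (p : Hd d) :
    horizontalCoeff d i (dil d r p) = r * horizontalCoeff d i p := by
  cases i <;> simp [dil, horizontalCoeff] <;> ring

theorem coe_horizontalField_inl {d : ℕ} (j : Fin d) (u : 𝓢(Hd d, ℂ)) :
    (horizontalField d (.inl j) u : Hd d → ℂ) = Xop d j u := by
  ext p
  rw [horizontalField, vectorField_apply, Xop]
  congr 1
  simp [horizontalVec, horizontalCoeff]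

theorem coe_horizontalField_inr {d : ℕ} (j : Fin d) (u : 𝓢(Hd d, ℂ)) :
    (horizontalField d (.inr j) u : Hd d → ℂ) = Yop d j u := by
  ext p
  rw [horizontalField, vectorField_apply, Yop]
  congr 1
  simp [horizontalVec, horizontalCoeff]

/-- The operator `-Δ_H` on Schwartz functions. -/
def negSubLap (d : ℕ) : 𝓢(Hd d, ℂ) →L[ℂ] 𝓢(Hd d, ℂ) :=
  -∑ i, horizontalField d i ∘L horizontalField d i

theorem negSubLap_apply_eq {d : ℕ} (u : 𝓢(Hd d, ℂ)) :
    negSubLap d u = -∑ i, horizontalField d i (horizontalField d i u) := by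
  simp [negSubLap]

theorem negSubLap_apply {d : ℕ} (u : 𝓢(Hd d, ℂ)) (p : Hd d) :
    negSubLap d u p = -subLap d u p := by
  rw [negSubLap_apply_eq, subLap, neg_apply, sum_apply,
    Fintype.sum_sum_type, Finset.sum_add_distrib]
  simp only [coe_horizontalField_inl, coe_horizontalField_inr]

/-- The embedding of Schwartz functions into `L²`. -/
def schwartzToL2 (d : ℕ) : 𝓢(Hd d, ℂ) →L[ℂ] Lp ℂ 2 (volume : Measure (Hd d)) :=
  SchwartzMap.toLpCLM ℂ ℂ 2 volume

theorem schwartzToL2_coeFn {d : ℕ} (u : 𝓢(Hd d, ℂ)) : schwartzToL2 d u =ᵐ[volume] u :=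
  u.coeFn_toLp 2 volume

theorem inner_horizontalField_right {d : ℕ} (i : Fin d ⊕ Fin d) (f g : 𝓢(Hd d, ℂ)) :
    ⟪schwartzToL2 d f, schwartzToL2 d (horizontalField d i g)⟫_ℂ =
      -⟪schwartzToL2 d (horizontalField d i f), schwartzToL2 d g⟫_ℂ :=
  inner_vectorField_right _ (by cases i <;> simp [horizontalCoeff]) f g

theorem inner_negSubLap_right {d : ℕ} (f g : 𝓢(Hd d, ℂ)) :
    ⟪schwartzToL2 d f, schwartzToL2 d (negSubLap d g)⟫_ℂ =
      ∑ i, ⟪schwartzToL2 d (horizontalField d i f), schwartzToL2 d (horizontalField d i g)⟫_ℂ := by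
  rw [negSubLap_apply_eq, map_neg, map_sum, inner_neg_right, inner_sum,
    ← Finset.sum_neg_distrib]
  exact Finset.sum_congr rfl fun i _ => by rw [inner_horizontalField_right, neg_neg]

theorem inner_negSubLap_left {d : ℕ} (f g : 𝓢(Hd d, ℂ)) :
    ⟪schwartzToL2 d (negSubLap d f), schwartzToL2 d g⟫_ℂ =
      ∑ i, ⟪schwartzToL2 d (horizontalField d i f), schwartzToL2 d (horizontalField d i g)⟫_ℂ := by
  rw [← inner_conj_symm, inner_negSubLap_right, map_sum]
  exact Finset.sum_congr rfl fun i _ => inner_conj_symm _ _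

theorem dilOp_schwartzToL2 {d : ℕ} {ρ : ℝ} (hρ : 1 ≤ ρ) (u : 𝓢(Hd d, ℂ)) :
    dilOp d ρ (schwartzToL2 d u) =
      schwartzToL2 d (schwartzDil d (one_pos.trans_le hρ).ne' u) :=
  dilOp_toLp hρ u

theorem horizontalField_schwartzDil {d : ℕ} (i : Fin d ⊕ Fin d) {r : ℝ} (hr : r ≠ 0)
    (u : 𝓢(Hd d, ℂ)) : horizontalField d i (schwartzDil d hr u) =
      (r : ℂ) • schwartzDil d hr (horizontalField d i u) :=
  vectorField_schwartzDil (dil_horizontalVec i) (horizontalCoeff_dil i) hr u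

theorem negSubLap_schwartzDil {d : ℕ} {r : ℝ} (hr : r ≠ 0) (u : 𝓢(Hd d, ℂ)) :
    negSubLap d (schwartzDil d hr u) = (r : ℂ) ^ 2 • schwartzDil d hr (negSubLap d u) := by
  simp only [negSubLap_apply_eq, horizontalField_schwartzDil, map_smul, smul_smul, map_neg,
    map_sum, smul_neg, Finset.smul_sum, sq]

theorem sq_mul_inner_dilOp_negSubLap {d : ℕ} {ρ : ℝ} (hρ : 1 ≤ ρ) (f g : 𝓢(Hd d, ℂ)) :
    (ρ : ℂ) ^ 2 * ⟪schwartzToL2 d f, dilOp d ρ (schwartzToL2 d (negSubLap d g))⟫_ℂ =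
      ⟪schwartzToL2 d (negSubLap d f), dilOp d ρ (schwartzToL2 d g)⟫_ℂ := by
  rw [dilOp_schwartzToL2 hρ, dilOp_schwartzToL2 hρ, ← inner_smul_right, ← map_smul,
    ← negSubLap_schwartzDil, inner_negSubLap_right, inner_negSubLap_left]

theorem mul_inner_dilOp_negSubLap {d : ℕ} {ρ : ℝ} (hρ : 1 ≤ ρ) (f g : 𝓢(Hd d, ℂ)) :
    (ρ : ℂ) * ⟪schwartzToL2 d f, dilOp d ρ (schwartzToL2 d (negSubLap d g))⟫_ℂ =
      ∑ i, ⟪schwartzToL2 d (horizontalField d i f),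
        dilOp d ρ (schwartzToL2 d (horizontalField d i g))⟫_ℂ := by
  have h0 : (ρ : ℂ) ≠ 0 := by exact_mod_cast (one_pos.trans_le hρ).ne'
  refine mul_left_cancel₀ h0 ?_
  rw [← mul_assoc, ← sq, sq_mul_inner_dilOp_negSubLap hρ, dilOp_schwartzToL2 hρ,
    inner_negSubLap_left, Finset.mul_sum]
  refine Finset.sum_congr rfl fun i _ => ?_
  rw [horizontalField_schwartzDil, dilOp_schwartzToL2 hρ, map_smul, inner_smul_right]

theorem pow_three_mul_norm_inner_dilOp_negSubLap_le {d : ℕ} (hd : 1 ≤ d) {ρ : ℝ} (hρ : 1 ≤ ρ)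
    (u : 𝓢(Hd d, ℂ)) :
    ρ ^ 3 * ‖⟪schwartzToL2 d u, dilOp d ρ (schwartzToL2 d (negSubLap d u))⟫_ℂ‖ ≤
      (⟪schwartzToL2 d u, schwartzToL2 d (negSubLap d u)⟫_ℂ).re := by
  have h0 : 0 < ρ := one_pos.trans_le hρ
  have h1 := congrArg norm (mul_inner_dilOp_negSubLap hρ u u)
  rw [norm_mul, Complex.norm_of_nonneg h0.le] at h1
  rw [pow_succ, mul_assoc, h1, inner_negSubLap_right, Complex.re_sum]
  refine (mul_le_mul_of_nonneg_left (norm_sum_le _ _) (sq_nonneg ρ)).trans ?_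
  rw [Finset.mul_sum]
  refine Finset.sum_le_sum fun i _ => ?_
  set g := schwartzToL2 d (horizontalField d i u)
  have h2 : (⟪g, g⟫_ℂ).re = ‖g‖ ^ 2 := (norm_sq_eq_re_inner (𝕜 := ℂ) g).symm
  rw [h2]
  calc ρ ^ 2 * ‖⟪g, dilOp d ρ g⟫_ℂ‖ ≤ ρ ^ 2 * (‖g‖ * ‖dilOp d ρ g‖) := by
        gcongr; exact norm_inner_le_norm _ _
    _ = ‖g‖ * (ρ ^ 2 * ‖dilOp d ρ g‖) := by ring
    _ ≤ ‖g‖ * ‖g‖ := by gcongr; exact sq_mul_norm_dilOp_le hd hρ g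
    _ = ‖g‖ ^ 2 := by ring

theorem measurableEmbedding_dil (d : ℕ) {r : ℝ} (hr : r ≠ 0) : MeasurableEmbedding (dil d r) :=
  (dilEquiv d hr).toHomeomorph.measurableEmbedding

theorem integral_comp_dil {d : ℕ} {E : Type*} [NormedAddCommGroup E] [NormedSpace ℝ E] {r : ℝ}
    (hr : 0 < r) (h : Hd d → E) :
    ∫ p, h (dil d r p) = (r ^ (2 * d + 2))⁻¹ • ∫ p, h p := by
  rw [← (measurableEmbedding_dil d hr.ne').integral_map, map_dil d hr, integral_smul_measure,
    ENNReal.toReal_ofReal (by positivity)]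

theorem integrable_comp_dil {d : ℕ} {E : Type*} [NormedAddCommGroup E] {r : ℝ}
    (hr : 0 < r) {h : Hd d → E} (hh : Integrable h) : Integrable fun p => h (dil d r p) := by
  refine (measurableEmbedding_dil d hr.ne').integrable_map_iff.1 ?_
  rw [map_dil d hr]
  exact hh.smul_measure ENNReal.ofReal_ne_top

theorem integrableOn_Ioi_inv_pow {d : ℕ} (hd : 1 ≤ d) :
    IntegrableOn (fun r : ℝ => (r ^ (2 * d + 1))⁻¹) (Ioi 1) ∧
      ∫ r in Ioi (1 : ℝ), (r ^ (2 * d + 1))⁻¹ = (2 * d : ℝ)⁻¹ := by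
  have hd' : (1 : ℝ) ≤ d := by exact_mod_cast hd
  have h : EqOn (fun r : ℝ => r ^ (-(2 * d + 1 : ℝ))) (fun r => (r ^ (2 * d + 1))⁻¹) (Ioi 1) := by
    intro r hr
    have : 0 < r := one_pos.trans hr
    simp only
    rw [Real.rpow_neg this.le]
    norm_cast
  refine ⟨(integrableOn_Ioi_rpow_of_lt (by linarith) one_pos).congr_fun h measurableSet_Ioi, ?_⟩
  rw [← setIntegral_congr_fun measurableSet_Ioi h, integral_Ioi_rpow_of_lt (by linarith) one_pos,
    Real.one_rpow, show -(2 * d + 1 : ℝ) + 1 = -(2 * d) by ring, neg_div_neg_eq, one_div]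

theorem SchwartzMap.norm_comp_dil_le {d : ℕ} (F : 𝓢(Hd d, ℂ)) {p : Hd d} (hp : p ≠ 0) :
    ∃ C : ℝ, ∀ r, 1 ≤ r → ‖F (dil d r p)‖ ≤ C / r ^ 2 := by
  refine ⟨SchwartzMap.seminorm ℝ 2 0 F / ‖p‖ ^ 2, fun r hr => ?_⟩
  have h0 : 0 < r := one_pos.trans_le hr
  have hp' : 0 < ‖p‖ := norm_pos_iff.2 hp
  have h1 : r * ‖p‖ ≤ ‖dil d r p‖ := by
    simp only [dil, Prod.norm_def, norm_smul, norm_mul, norm_pow, Real.norm_of_nonneg h0.le]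
    rw [mul_max_of_nonneg _ _ h0.le, mul_max_of_nonneg _ _ h0.le]
    gcongr
    nlinarith
  have h2 := SchwartzMap.norm_pow_mul_le_seminorm ℝ F 2 (dil d r p)
  rw [div_div, le_div_iff₀ (by positivity)]
  refine le_trans ?_ h2
  rw [mul_comm, ← mul_pow, mul_comm ‖p‖]
  gcongr

theorem SchwartzMap.integrable_norm_sq {d : ℕ} (F : 𝓢(Hd d, ℂ)) :
    Integrable fun p => ‖F p‖ ^ 2 :=
  (memLp_two_iff_integrable_sq_norm F.continuous.aestronglyMeasurable).1 (F.memLp 2 volume)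

theorem SchwartzMap.integrable_norm_mul_norm_comp_dil {d : ℕ} (F : 𝓢(Hd d, ℂ)) {ρ : ℝ}
    (hρ : 0 < ρ) : Integrable fun p => ‖F p‖ * ‖F (dil d ρ p)‖ :=
  (F.memLp 2 volume).norm.integrable_mul ((schwartzDil d hρ.ne' F).memLp 2 volume).norm

theorem SchwartzMap.integrableOn_integral_norm_mul {d : ℕ} (hd : 1 ≤ d) (F : 𝓢(Hd d, ℂ)) :
    IntegrableOn (fun ρ => ∫ p, ‖F p‖ * ‖F (dil d ρ p)‖) (Ioi 1) := by
  set N := ∫ p, ‖F p‖ ^ 2 with hN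
  have hN0 : 0 ≤ N := integral_nonneg fun _ => by positivity
  have hb : IntegrableOn (fun r : ℝ => N * r ^ (-2 : ℝ)) (Ioi 1) :=
    (integrableOn_Ioi_rpow_of_lt (by norm_num) one_pos).const_mul N
  have hmeas : StronglyMeasurable fun ρ => ∫ p, ‖F p‖ * ‖F (dil d ρ p)‖ := by
    refine StronglyMeasurable.integral_prod_right' (f := fun q : ℝ × Hd d =>
      ‖F q.2‖ * ‖F (dil d q.1 q.2)‖) (Continuous.stronglyMeasurable ?_)
    exact (F.continuous.comp continuous_snd).norm.mul
      (F.continuous.comp (continuous_uncurry_dil d)).norm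
  refine hb.mono' hmeas.aestronglyMeasurable.restrict
    ((ae_restrict_mem measurableSet_Ioi).mono fun ρ hρ => ?_)
  have hρ : (1 : ℝ) < ρ := hρ
  have h0 : 0 < ρ := one_pos.trans hρ
  rw [Real.norm_of_nonneg (integral_nonneg fun _ => by positivity)]
  set l := (ρ ^ (d + 1))⁻¹ with hl
  have hl0 : 0 < l := by positivity
  calc ∫ p, ‖F p‖ * ‖F (dil d ρ p)‖
      ≤ ∫ p, (l / 2 * ‖F p‖ ^ 2 + l⁻¹ / 2 * ‖F (dil d ρ p)‖ ^ 2) := by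
        refine integral_mono (F.integrable_norm_mul_norm_comp_dil h0)
          ((F.integrable_norm_sq.const_mul _).add
            ((integrable_comp_dil h0 F.integrable_norm_sq).const_mul _)) fun p => ?_
        have : 0 ≤ l⁻¹ / 2 * (l * ‖F p‖ - ‖F (dil d ρ p)‖) ^ 2 := by positivity
        have e : l⁻¹ / 2 * (l * ‖F p‖ - ‖F (dil d ρ p)‖) ^ 2 =
          l / 2 * ‖F p‖ ^ 2 + l⁻¹ / 2 * ‖F (dil d ρ p)‖ ^ 2 - ‖F p‖ * ‖F (dil d ρ p)‖ := by
          field_simp; ring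
        simp only
        linarith
    _ = l * N := by
        rw [integral_add (F.integrable_norm_sq.const_mul _)
          ((integrable_comp_dil h0 F.integrable_norm_sq).const_mul _), integral_const_mul,
          integral_const_mul, integral_comp_dil h0 fun p => ‖F p‖ ^ 2, ← hN, smul_eq_mul]
        have : (ρ ^ (2 * d + 2))⁻¹ = l ^ 2 := by rw [hl, inv_pow, ← pow_mul]; ring_nf
        rw [this]
        field_simp
        ring
    _ ≤ N * ρ ^ (-2 : ℝ) := by
        rw [mul_comm]
        refine mul_le_mul_of_nonneg_left ?_ hN0
        rw [Real.rpow_neg h0.le, hl]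
        refine inv_anti₀ (by positivity) ?_
        rw [Real.rpow_two]
        exact pow_le_pow_right₀ hρ.le (by omega)

theorem SchwartzMap.integral_norm_sq_integral_dil {d : ℕ} (hd : 1 ≤ d) (F : 𝓢(Hd d, ℂ)) :
    Integrable (fun p => ‖∫ r in Ioi (1 : ℝ), F (dil d r p)‖ ^ 2) ∧
      ∫ p, ‖∫ r in Ioi (1 : ℝ), F (dil d r p)‖ ^ 2 =
        (d : ℝ)⁻¹ *
          (∫ ρ in Ioi (1 : ℝ), ⟪schwartzToL2 d F, dilOp d ρ (schwartzToL2 d F)⟫_ℂ).re := by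
  set μ₁ : Measure ℝ := volume.restrict (Ioi 1) with hμ₁
  set Φ : Hd d × ℝ × ℝ → ℂ := fun q =>
    (q.2.1 : ℂ) * conj (F (dil d q.2.1 q.1)) * F (dil d (q.2.2 * q.2.1) q.1) with hΦ
  have hΦc : Continuous Φ := by
    have h1 : Continuous fun q : Hd d × ℝ × ℝ => dil d q.2.1 q.1 := by unfold dil; fun_prop
    have h2 : Continuous fun q : Hd d × ℝ × ℝ => dil d (q.2.2 * q.2.1) q.1 := by
      unfold dil; fun_prop
    have h3 := F.continuous
    simp only [hΦ]
    fun_prop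
  have hae : ∀ᵐ q : ℝ × ℝ ∂(μ₁.prod μ₁), 1 < q.1 ∧ 1 < q.2 := by
    rw [hμ₁, Measure.prod_restrict]
    exact ae_restrict_mem (measurableSet_Ioi.prod measurableSet_Ioi)
  have hnorm : ∀ r ρ : ℝ, 0 < r → ∀ p, ‖Φ (p, r, ρ)‖ =
      r * (fun p => ‖F p‖ * ‖F (dil d ρ p)‖) (dil d r p) := fun r ρ hr p => by
    simp only [hΦ, norm_mul, Complex.norm_of_nonneg hr.le, RCLike.norm_conj, dil_dil]
    ring
  have hint : Integrable Φ (volume.prod (μ₁.prod μ₁)) := by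
    rw [integrable_prod_iff' hΦc.aestronglyMeasurable]
    constructor
    · filter_upwards [hae] with q hq
      have h1 : 0 < q.1 := one_pos.trans hq.1
      have h2 : 0 < q.2 := one_pos.trans hq.2
      refine (integrable_norm_iff (Continuous.aestronglyMeasurable (by fun_prop))).1 ?_
      simp only [hnorm q.1 q.2 h1]
      exact (integrable_comp_dil h1 (F.integrable_norm_mul_norm_comp_dil h2)).const_mul _
    · refine ((integrableOn_Ioi_inv_pow hd).1.mul_prod
        (F.integrableOn_integral_norm_mul hd)).congr ?_
      filter_upwards [hae] with q hq
      have h1 : 0 < q.1 := one_pos.trans hq.1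
      simp only [hnorm q.1 q.2 h1]
      rw [integral_const_mul, integral_comp_dil h1 fun p => ‖F p‖ * ‖F (dil d q.2 p)‖, smul_eq_mul,
        ← mul_assoc]
      congr 1
      field_simp
      ring
  have hG : ∀ᵐ p : Hd d, ‖∫ r in Ioi (1 : ℝ), F (dil d r p)‖ ^ 2 =
      2 * (∫ q, Φ (p, q) ∂(μ₁.prod μ₁)).re := by
    have : Nontrivial (Hd d) := ⟨0, (0, 0, 1), fun h => zero_ne_one (congrArg (fun p => p.2.2) h)⟩
    have : NullSingletonClass (volume : Measure (Hd d)) :=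
      Measure.IsAddHaarMeasure.nullSingletonClass _
    have : ∀ᵐ p : Hd d, p ≠ 0 := Measure.ae_ne volume 0
    filter_upwards [this, hint.prod_right_ae] with p hp hpi
    obtain ⟨C, hC⟩ := F.norm_comp_dil_le hp
    rw [norm_sq_integral_Ioi_eq (φ := fun r => F (dil d r p))
      (F.continuous.comp (by unfold dil; fun_prop)) hC, integral_prod _ hpi]
  refine ⟨(hint.integral_prod_left.re.const_mul 2).congr (hG.mono fun p hp => hp.symm), ?_⟩
  rw [integral_congr_ae hG, integral_const_mul]
  have e1 : ∫ p, (∫ q, Φ (p, q) ∂(μ₁.prod μ₁)).re = (∫ p, ∫ q, Φ (p, q) ∂(μ₁.prod μ₁)).re :=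
    integral_re hint.integral_prod_left
  have e2 : ∫ p, ∫ q, Φ (p, q) ∂(μ₁.prod μ₁) =
      ∫ q : ℝ × ℝ, ((q.1 ^ (2 * d + 1))⁻¹ : ℝ) *
        ⟪schwartzToL2 d F, dilOp d q.2 (schwartzToL2 d F)⟫_ℂ ∂(μ₁.prod μ₁) := by
    rw [integral_integral_swap hint]
    refine integral_congr_ae ?_
    filter_upwards [hae] with q hq
    have h1 : 0 < q.1 := one_pos.trans hq.1
    rw [dilOp_schwartzToL2 hq.2.le]
    have := inner_toLp_toLp F (schwartzDil d (one_pos.trans_le hq.2.le).ne' F)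
    have e3 : ∀ p, Φ (p, q) = q.1 * (fun p => conj (F p) * F (dil d q.2 p)) (dil d q.1 p) := by
      intro p
      simp only [hΦ, dil_dil]
      ring
    simp only [e3]
    rw [integral_const_mul, integral_comp_dil h1 fun p => conj (F p) * F (dil d q.2 p)]
    refine Eq.trans ?_ (congrArg _ this.symm)
    simp only [RCLike.inner_apply, schwartzDil_apply, Complex.real_smul, mul_comm (F (dil d q.2 _))]
    rw [← mul_assoc]
    congr 1
    push_cast
    have : (q.1 : ℂ) ≠ 0 := by exact_mod_cast h1.ne'
    field_simp
    ring
  have e4 : ∫ r, (((r ^ (2 * d + 1))⁻¹ : ℝ) : ℂ) ∂μ₁ = ((2 * d : ℝ)⁻¹ : ℝ) :=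
    integral_ofReal.trans (congrArg _ (integrableOn_Ioi_inv_pow hd).2)
  rw [e1, e2, integral_prod_mul (μ := μ₁) (ν := μ₁) (fun r => (((r ^ (2 * d + 1))⁻¹ : ℝ) : ℂ))
    fun ρ => ⟪schwartzToL2 d F, dilOp d ρ (schwartzToL2 d F)⟫_ℂ, e4, Complex.re_ofReal_mul]
  field_simp

/-- The components of `|z|²` times the dilation generator in the frame `X_j, Y_j`, modulo `N`. -/
def radialCoeff (d : ℕ) (p : Hd d) : Fin d ⊕ Fin d → ℝ
  | .inl j => zsq d p * p.1 j + p.2.2 * p.2.1 j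
  | .inr j => zsq d p * p.2.1 j - p.2.2 * p.1 j

theorem zsq_nonneg {d : ℕ} (p : Hd d) : 0 ≤ zsq d p := by unfold zsq; positivity

theorem zsq_eq_sum {d : ℕ} (p : Hd d) : zsq d p = ∑ j, (p.1 j ^ 2 + p.2.1 j ^ 2) := by
  rw [zsq, EuclideanSpace.real_norm_sq_eq, EuclideanSpace.real_norm_sq_eq, Finset.sum_add_distrib]

theorem sum_radialCoeff_sq {d : ℕ} (p : Hd d) :
    ∑ i, radialCoeff d p i ^ 2 = zsq d p * (zsq d p ^ 2 + p.2.2 ^ 2) := by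
  rw [Fintype.sum_sum_type, ← Finset.sum_add_distrib]
  nth_rw 1 [zsq_eq_sum]
  rw [Finset.sum_mul]
  refine Finset.sum_congr rfl fun j _ => ?_
  simp only [radialCoeff]
  ring

theorem sum_radialCoeff_smul {d : ℕ} {r : ℝ} (hr : r ≠ 0) (p : Hd d) :
    ∑ i, radialCoeff d p i • (horizontalVec d i + (0, 0, horizontalCoeff d i (dil d r p))) =
      zsq d p • ((p.1, p.2.1, 2 * r * p.2.2) : Hd d) +
        (p.2.2 / r) • (((dil d r p).2.1, -(dil d r p).1, 0) : Hd d) := by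
  have h3 : ∑ j, (radialCoeff d p (.inl j) * (2 * (r * p.2.1 j)) +
      radialCoeff d p (.inr j) * (-2 * (r * p.1 j))) = zsq d p * (2 * r * p.2.2) := by
    nth_rw 1 [zsq_eq_sum]
    rw [Finset.sum_mul]
    refine Finset.sum_congr rfl fun j _ => ?_
    simp only [radialCoeff]
    ring
  rw [Fintype.sum_sum_type]
  refine Prod.ext ?_ (Prod.ext ?_ ?_)
  · ext k
    simp [horizontalVec, Prod.fst_sum, dil, radialCoeff, Finset.sum_apply, Pi.single_apply]
    field_simp
  · ext k
    simp [horizontalVec, Prod.fst_sum, Prod.snd_sum, dil, radialCoeff, Finset.sum_apply,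
      Pi.single_apply]
    field_simp
    ring
  · rw [Finset.sum_add_distrib] at h3
    simpa [horizontalVec, horizontalCoeff, Prod.snd_sum, dil] using h3

theorem SchwartzMap.zsq_mul_deriv_dil {d : ℕ} (u : 𝓢(Hd d, ℂ)) (hN : ∀ p, Nop d u p = 0) (p : Hd d)
    {r : ℝ} (hr : r ≠ 0) :
    HasDerivAt (fun r => (zsq d p : ℂ) * u (dil d r p))
      (∑ i, (radialCoeff d p i : ℂ) * horizontalField d i u (dil d r p)) r := by
  have h1 : HasDerivAt (fun r => dil d r p) (p.1, p.2.1, 2 * r * p.2.2) r := by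
    have e1 : HasDerivAt (fun r : ℝ => r • p.1) p.1 r := by
      simpa using (hasDerivAt_id r).smul_const p.1
    have e2 : HasDerivAt (fun r : ℝ => r • p.2.1) p.2.1 r := by
      simpa using (hasDerivAt_id r).smul_const p.2.1
    have e3 : HasDerivAt (fun r : ℝ => r ^ 2 * p.2.2) (2 * r * p.2.2) r := by
      simpa using (hasDerivAt_pow 2 r).mul_const p.2.2
    exact e1.prodMk (e2.prodMk e3)
  have h2 := ((u.hasFDerivAt (dil d r p)).comp_hasDerivAt r h1).const_mul (zsq d p : ℂ)
  refine h2.congr_deriv ?_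
  have h3 := congrArg (fderiv ℝ u (dil d r p)) (sum_radialCoeff_smul hr p)
  have h4 : fderiv ℝ u (dil d r p) ((dil d r p).2.1, -(dil d r p).1, 0) = 0 := hN _
  rw [map_add, map_smul, map_smul, h4, smul_zero, add_zero, map_sum] at h3
  simp only [map_smul, Complex.real_smul] at h3
  rw [← h3]
  simp only [horizontalField, vectorField_apply]

theorem SchwartzMap.integrableOn_dil {d : ℕ} (F : 𝓢(Hd d, ℂ)) {p : Hd d} (hp : p ≠ 0) :
    IntegrableOn (fun r => F (dil d r p)) (Ioi 1) := by
  obtain ⟨C, hC⟩ := F.norm_comp_dil_le hp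
  exact integrableOn_Ioi_of_norm_le_div_sq (F.continuous.comp (by unfold dil; fun_prop)) hC

theorem SchwartzMap.zsq_mul_eq {d : ℕ} (u : 𝓢(Hd d, ℂ)) (hN : ∀ p, Nop d u p = 0) {p : Hd d}
    (hp : p ≠ 0) :
    (zsq d p : ℂ) * u p = -∑ i, (radialCoeff d p i : ℂ) *
      ∫ r in Ioi (1 : ℝ), horizontalField d i u (dil d r p) := by
  have hlim : Tendsto (fun r => (zsq d p : ℂ) * u (dil d r p)) atTop (𝓝 0) := by
    obtain ⟨C, hC⟩ := u.norm_comp_dil_le hp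
    rw [← mul_zero (zsq d p : ℂ)]
    refine Tendsto.const_mul _ (squeeze_zero_norm' ((eventually_ge_atTop 1).mono hC) ?_)
    exact Tendsto.div_atTop tendsto_const_nhds (tendsto_pow_atTop two_ne_zero)
  have hint : ∀ i, IntegrableOn
      (fun r => (radialCoeff d p i : ℂ) * horizontalField d i u (dil d r p)) (Ioi 1) :=
    fun i => ((horizontalField d i u).integrableOn_dil hp).const_mul _
  have h := integral_Ioi_of_hasDerivAt_of_tendsto'
    (fun r hr => u.zsq_mul_deriv_dil hN p (one_pos.trans_le (mem_Ici.1 hr)).ne')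
    (integrable_finsetSum _ fun i _ => hint i) hlim
  rw [integral_finsetSum _ fun i _ => hint i] at h
  simp only [integral_const_mul] at h
  rw [h]
  simp [dil]

theorem w4_sq {d : ℕ} (p : Hd d) : w4 d p ^ 2 = zsq d p / (zsq d p ^ 2 + p.2.2 ^ 2) := by
  have h : zn d p ^ 2 = zsq d p := Real.sq_sqrt (zsq_nonneg p)
  rw [w4, div_pow, h, Real.sq_sqrt (by positivity), show zn d p ^ 4 = (zn d p ^ 2) ^ 2 by ring, h]

theorem SchwartzMap.w4_sq_mul_norm_sq_le {d : ℕ} (u : 𝓢(Hd d, ℂ)) (hN : ∀ p, Nop d u p = 0)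
    (p : Hd d) :
    w4 d p ^ 2 * ‖u p‖ ^ 2 ≤
      ∑ i, ‖∫ r in Ioi (1 : ℝ), horizontalField d i u (dil d r p)‖ ^ 2 := by
  set G := fun i => ∫ r in Ioi (1 : ℝ), horizontalField d i u (dil d r p)
  have hG : 0 ≤ ∑ i, ‖G i‖ ^ 2 := Finset.sum_nonneg fun _ _ => by positivity
  rw [w4_sq]
  rcases (zsq_nonneg p).eq_or_lt with h0 | h0
  · simpa [← h0] using hG
  have hp : p ≠ 0 := by
    rintro rfl
    simp [zsq] at h0
  have h1 : zsq d p * ‖u p‖ ≤ ∑ i, |radialCoeff d p i| * ‖G i‖ := by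
    have := congrArg norm (u.zsq_mul_eq hN hp)
    rw [norm_mul, Complex.norm_of_nonneg h0.le, norm_neg] at this
    rw [this]
    refine (norm_sum_le _ _).trans (Finset.sum_le_sum fun i _ => ?_)
    rw [norm_mul, Complex.norm_real, Real.norm_eq_abs]
  have h2 : (zsq d p * ‖u p‖) ^ 2 ≤ zsq d p * (zsq d p ^ 2 + p.2.2 ^ 2) * ∑ i, ‖G i‖ ^ 2 := by
    refine (pow_le_pow_left₀ (by positivity) h1 2).trans
      ((Finset.sum_mul_sq_le_sq_mul_sq _ _ _).trans_eq ?_)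
    simp only [sq_abs, sum_radialCoeff_sq]
  rw [div_mul_eq_mul_div, div_le_iff₀ (by positivity)]
  refine le_of_mul_le_mul_left ?_ h0
  calc zsq d p * (zsq d p * ‖u p‖ ^ 2) = (zsq d p * ‖u p‖) ^ 2 := by ring
    _ ≤ _ := h2
    _ = _ := by ring

theorem enorm_lp_two_sq {α : Type*} [MeasurableSpace α] {μ : Measure α} (f : Lp ℂ 2 μ) :
    ‖f‖ₑ ^ 2 = ∫⁻ x, ‖f x‖ₑ ^ 2 ∂μ := by
  rw [Lp.enorm_def]
  have := eLpNorm_nnreal_pow_eq_lintegral (f := f) (μ := μ) (p := 2) two_ne_zero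
  simpa using this

theorem norm_lp_two_sq {α : Type*} [MeasurableSpace α] {μ : Measure α} (f : Lp ℂ 2 μ) :
    Integrable (fun x => ‖f x‖ ^ 2) μ ∧ ‖f‖ ^ 2 = ∫ x, ‖f x‖ ^ 2 ∂μ := by
  refine ⟨(memLp_two_iff_integrable_sq_norm (Lp.aestronglyMeasurable f)).1 (Lp.memLp f), ?_⟩
  rw [@norm_sq_eq_re_inner ℂ, L2.inner_def, ← integral_re (L2.integrable_inner f f)]
  simp only [← norm_sq_eq_re_inner]

theorem integrableOn_inner_dilOp {d : ℕ} (hd : 1 ≤ d) (g : Lp ℂ 2 (volume : Measure (Hd d))) :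
    IntegrableOn (fun ρ => ⟪g, dilOp d ρ g⟫_ℂ) (Ioi 1) := by
  have h1 : IntegrableOn (fun r : ℝ => ‖g‖ ^ 2 * r ^ (-2 : ℝ)) (Ioi 1) :=
    (integrableOn_Ioi_rpow_of_lt (by norm_num) one_pos).const_mul _
  refine h1.mono' (aestronglyMeasurable_inner_dilOp g g)
    ((ae_restrict_mem measurableSet_Ioi).mono fun ρ hρ => ?_)
  have h0 : 0 < ρ := one_pos.trans hρ
  rw [Real.rpow_neg h0.le, Real.rpow_two, ← div_eq_mul_inv, le_div_iff₀ (by positivity)]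
  calc ‖⟪g, dilOp d ρ g⟫_ℂ‖ * ρ ^ 2 ≤ ‖g‖ * ‖dilOp d ρ g‖ * ρ ^ 2 := by
        gcongr; exact norm_inner_le_norm _ _
    _ = ‖g‖ * (ρ ^ 2 * ‖dilOp d ρ g‖) := by ring
    _ ≤ ‖g‖ * ‖g‖ := by gcongr; exact sq_mul_norm_dilOp_le hd (le_of_lt hρ) g
    _ = ‖g‖ ^ 2 := by ring

theorem norm_mulOp_sq_le {d : ℕ} (hd : 1 ≤ d) {m : Hd d → ℝ} {C : ℝ} (hm : Measurable m)
    (hC : ∀ x, ‖m x‖ ≤ C) (hw : ∀ x, ‖m x‖ ≤ w4 d x) (u : 𝓢(Hd d, ℂ))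
    (hN : ∀ p, Nop d u p = 0) :
    ‖mulOp hm hC (schwartzToL2 d u)‖ ^ 2 ≤ ∫ ρ in Ioi (1 : ℝ),
      ρ * ‖⟪schwartzToL2 d u, dilOp d ρ (schwartzToL2 d (negSubLap d u))⟫_ℂ‖ := by
  set g := fun i => schwartzToL2 d (horizontalField d i u) with hg
  have hint : IntegrableOn (fun ρ => ∑ i, ⟪g i, dilOp d ρ (g i)⟫_ℂ) (Ioi 1) :=
    integrable_finsetSum _ fun i _ => integrableOn_inner_dilOp hd _
  have hd' : (1 : ℝ) ≤ d := by exact_mod_cast hd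
  have h1 := norm_lp_two_sq (mulOp hm hC (schwartzToL2 d u))
  have hG := fun i => (horizontalField d i u).integral_norm_sq_integral_dil hd
  calc ‖mulOp hm hC (schwartzToL2 d u)‖ ^ 2
      ≤ ∫ p, ∑ i, ‖∫ r in Ioi (1 : ℝ), horizontalField d i u (dil d r p)‖ ^ 2 := by
        rw [h1.2]
        refine integral_mono_ae h1.1 (integrable_finsetSum _ fun i _ => (hG i).1) ?_
        filter_upwards [mulOp_coeFn hm hC (schwartzToL2 d u), schwartzToL2_coeFn u] with p h2 h3
        rw [h2, h3, norm_mul, Complex.norm_real, mul_pow]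
        refine le_trans ?_ (u.w4_sq_mul_norm_sq_le hN p)
        gcongr
        exact hw p
    _ = (d : ℝ)⁻¹ * (∫ ρ in Ioi (1 : ℝ), ∑ i, ⟪g i, dilOp d ρ (g i)⟫_ℂ).re := by
        rw [integral_finsetSum _ fun i _ => (hG i).1,
          integral_finsetSum _ fun i _ => integrableOn_inner_dilOp hd _, Complex.re_sum,
          Finset.mul_sum]
        exact Finset.sum_congr rfl fun i _ => (hG i).2
    _ ≤ (d : ℝ)⁻¹ * ∫ ρ in Ioi (1 : ℝ), ‖∑ i, ⟪g i, dilOp d ρ (g i)⟫_ℂ‖ := by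
        gcongr
        exact (Complex.re_le_norm _).trans (norm_integral_le_integral_norm _)
    _ ≤ ∫ ρ in Ioi (1 : ℝ), ‖∑ i, ⟪g i, dilOp d ρ (g i)⟫_ℂ‖ :=
        mul_le_of_le_one_left (integral_nonneg fun _ => norm_nonneg _) (inv_le_one_of_one_le₀ hd')
    _ = _ := by
        refine setIntegral_congr_fun measurableSet_Ioi fun ρ hρ => ?_
        have h0 : (0 : ℝ) < ρ := one_pos.trans hρ
        simp only [hg]
        rw [← mul_inner_dilOp_negSubLap (le_of_lt hρ), norm_mul, Complex.norm_of_nonneg h0.le]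

/-- Schwartz functions annihilated by `N`. -/
def kerN (d : ℕ) : Submodule ℂ 𝓢(Hd d, ℂ) where
  carrier := {u | ∀ p, Nop d u p = 0}
  zero_mem' p := by
    rw [Nop, FunLike.coe_zero]
    simp
  add_mem' {f g} hf hg p := by
    have h := fderiv_add (f.differentiableAt (x := p)) (g.differentiableAt (x := p))
    have : Nop d (f + g) p = Nop d f p + Nop d g p := by
      rw [Nop, h]; rfl
    rw [FunLike.coe_add, this, hf p, hg p, add_zero]
  smul_mem' c f hf p := by
    have h := fderiv_const_smul (f.differentiableAt (x := p)) c
    have : Nop d (c • f) p = c • Nop d f p := by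
      rw [Nop, h]; rfl
    rw [FunLike.coe_smul, this, hf p, smul_zero]

/-- The graph of `-Δ_H` on `kerN` in `L² × L²`. -/
def subLapGraph (d : ℕ) :
    Submodule ℂ (Lp ℂ 2 (volume : Measure (Hd d)) × Lp ℂ 2 (volume : Measure (Hd d))) :=
  (kerN d).map ((schwartzToL2 d).prod (schwartzToL2 d ∘L negSubLap d)).toLinearMap

theorem virialSystem_subLapGraph {d : ℕ} (hd : 1 ≤ d) {m : Hd d → ℝ} {C : ℝ} (hm : Measurable m)
    (hC : ∀ x, ‖m x‖ ≤ C) (hw : ∀ x, ‖m x‖ ≤ w4 d x) :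
    VirialSystem (dilOp d) (mulOp hm hC)
      (subLapGraph d : Set (Lp ℂ 2 (volume : Measure (Hd d)) × Lp ℂ 2 volume)) where
  norm_le ρ hρ x := sq_mul_norm_dilOp_le hd hρ x
  aestronglyMeasurable := aestronglyMeasurable_inner_dilOp
  inner_symm := by
    rintro _ ⟨f, -, rfl⟩ _ ⟨g, -, rfl⟩
    exact (inner_negSubLap_right g f).trans (inner_negSubLap_left g f).symm
  inner_dilation := by
    rintro ρ hρ _ ⟨f, -, rfl⟩ _ ⟨g, -, rfl⟩
    exact sq_mul_inner_dilOp_negSubLap hρ g f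
  inner_le := by
    rintro ρ hρ _ ⟨f, -, rfl⟩
    exact pow_three_mul_norm_inner_dilOp_negSubLap_le hd hρ f
  norm_sq_le := by
    rintro _ ⟨f, hf, rfl⟩
    exact norm_mulOp_sq_le hd hm hC hw f hf

theorem w4_nonneg {d : ℕ} (p : Hd d) : 0 ≤ w4 d p := by unfold w4 zn; positivity

theorem measurable_w4 (d : ℕ) : Measurable (w4 d) := by unfold w4 zn zsq; fun_prop

theorem iSup_ofReal_min_sq_mul {w c : ℝ} (hw : 0 ≤ w) (hc : 0 ≤ c) :
    ⨆ n : ℕ, ENNReal.ofReal (min w n ^ 2 * c) = ENNReal.ofReal (w ^ 2 * c) := by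
  refine le_antisymm (iSup_le fun n => ?_) ?_
  · gcongr
    exact min_le_left _ _
  · obtain ⟨n, hn⟩ := exists_nat_ge w
    refine le_iSup_of_le n ?_
    rw [min_eq_left hn]

end

/-- Kato-type smoothing for the Schrödinger flow of the sublaplacian with
the homogeneous weight `w₄`, for data in `Ker N`: if `u(τ,·)` is Schwartz with `N u(τ,·) ≡ 0`
for every `τ`, the map `τ ↦ u(τ,·)` is continuously differentiable as an `L²`-valued map
(witnessed by `U` and its derivative `V`), and `i ∂_τ u = -Δ_H u`, then the space-time
weighted `L²` norm of `u` is controlled by the `L²` norm of the initial datum. -/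
theorem kato_smoothing_w4_kerN (d : ℕ) (hd : 1 ≤ d) :
    ∃ C : ℝ, 0 < C ∧
      ∀ (u : ℝ → SchwartzMap (Hd d) ℂ)
        (U V : ℝ → Lp ℂ 2 (volume : Measure (Hd d))),
        (∀ τ : ℝ, ∀ p : Hd d, Nop d (⇑(u τ)) p = 0) →
        (∀ τ : ℝ, (U τ : Hd d → ℂ) =ᵐ[volume] (fun p => u τ p)) →
        (∀ τ : ℝ, HasDerivAt U (V τ) τ) →
        Continuous V →
        (∀ τ : ℝ, (fun p => Complex.I * (V τ : Hd d → ℂ) p)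
            =ᵐ[volume] (fun p => -(subLap d (⇑(u τ)) p))) →
        ∫⁻ τ : ℝ, ∫⁻ p, ENNReal.ofReal (w4 d p ^ 2 * ‖u τ p‖ ^ 2) ≤
          ENNReal.ofReal C * ∫⁻ p, ENNReal.ofReal (‖u 0 p‖ ^ 2) := by
  obtain ⟨C, hC, hvirial⟩ := exists_virial_constant
  refine ⟨C, hC, fun u U V hN hU hUV hV heq => ?_⟩
  have hm : ∀ n : ℕ, Measurable fun p => min (w4 d p) n := fun n =>
    (measurable_w4 d).min measurable_const
  have habs : ∀ (n : ℕ) p, ‖min (w4 d p) n‖ = min (w4 d p) n := fun n p =>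
    Real.norm_of_nonneg (le_min (w4_nonneg p) n.cast_nonneg)
  have hmn : ∀ (n : ℕ) p, ‖min (w4 d p) n‖ ≤ n := fun n p => by
    rw [habs]; exact min_le_right _ _
  have hmw : ∀ (n : ℕ) p, ‖min (w4 d p) n‖ ≤ w4 d p := fun n p => by
    rw [habs]; exact min_le_left _ _
  have hmono : ∀ (c : ℝ) (p : Hd d), 0 ≤ c →
      Monotone fun n : ℕ => ENNReal.ofReal (min (w4 d p) n ^ 2 * c) := fun c p hc i j hij => by
    have := le_min (w4_nonneg p) (i.cast_nonneg (α := ℝ))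
    dsimp only
    gcongr
  have hUeq : ∀ τ, U τ = schwartzToL2 d (u τ) := fun τ =>
    Lp.ext ((hU τ).trans (schwartzToL2_coeFn (u τ)).symm)
  have hVeq : ∀ τ, Complex.I • V τ = schwartzToL2 d (negSubLap d (u τ)) := fun τ => by
    refine Lp.ext ?_
    filter_upwards [Lp.coeFn_smul Complex.I (V τ), heq τ, schwartzToL2_coeFn (negSubLap d (u τ))]
      with p h1 h2 h3
    rw [h1, h3, negSubLap_apply, ← h2, Pi.smul_apply, smul_eq_mul]
  have hmem : ∀ τ, (U τ, Complex.I • V τ) ∈ (subLapGraph d).topologicalClosure := fun τ =>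
    (subLapGraph d).le_topologicalClosure ⟨u τ, hN τ, by rw [hUeq, hVeq]; rfl⟩
  have hT : ∀ (n : ℕ) τ, ‖mulOp (hm n) (hmn n) (U τ)‖ₑ ^ 2 =
      ∫⁻ p, ENNReal.ofReal (min (w4 d p) n ^ 2 * ‖u τ p‖ ^ 2) := fun n τ => by
    rw [enorm_lp_two_sq]
    refine lintegral_congr_ae ?_
    filter_upwards [mulOp_coeFn (hm n) (hmn n) (U τ), hU τ] with p h1 h2
    rw [h1, h2, ← ofReal_norm, ← ENNReal.ofReal_pow (norm_nonneg _), norm_mul, mul_pow,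
      Complex.norm_real, habs]
  have hbound : ∀ n : ℕ, ∫⁻ τ, ∫⁻ p, ENNReal.ofReal (min (w4 d p) n ^ 2 * ‖u τ p‖ ^ 2) ≤
      ENNReal.ofReal C * ∫⁻ p, ENNReal.ofReal (‖u 0 p‖ ^ 2) := fun n => by
    have h := hvirial (K := (subLapGraph d).topologicalClosure)
      (virialSystem_subLapGraph hd (hm n) (hmn n) (hmw n)).closure
      (subLapGraph d).isClosed_topologicalClosure hUV hV hmem
    simp only [hT] at h
    refine h.trans_eq (congrArg _ ?_)
    rw [enorm_lp_two_sq]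
    refine lintegral_congr_ae ?_
    filter_upwards [hU 0] with p h1
    rw [h1, ← ofReal_norm, ← ENNReal.ofReal_pow (norm_nonneg _)]
  have hUc : Continuous U := continuous_iff_continuousAt.2 fun τ => (hUV τ).continuousAt
  have hsup : ∀ τ, ∫⁻ p, ENNReal.ofReal (w4 d p ^ 2 * ‖u τ p‖ ^ 2) =
      ⨆ n : ℕ, ∫⁻ p, ENNReal.ofReal (min (w4 d p) n ^ 2 * ‖u τ p‖ ^ 2) := fun τ => by
    rw [← lintegral_iSup]
    · refine lintegral_congr fun p => (iSup_ofReal_min_sq_mul (w4_nonneg p) (sq_nonneg _)).symm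
    · exact fun n => (((hm n).pow_const 2).mul
        ((u τ).continuous.norm.measurable.pow_const 2)).ennreal_ofReal
    · exact fun i j hij p => hmono _ p (sq_nonneg _) hij
  simp only [hsup]
  rw [lintegral_iSup]
  · exact iSup_le hbound
  · intro n
    simp only [← hT]
    exact ((mulOp (hm n) (hmn n)).continuous.comp hUc).enorm.measurable.pow_const 2
  · exact fun i j hij τ => lintegral_mono fun p => hmono _ p (sq_nonneg _) hij
end
end

section
/- (Gronwall-type inequality.) Let a < b be real numbers, let f : (a,b) → [0,∞) be continuous, and let u₁, u₂ ∈ L¹((a,b)) be nonnegative. Assume that for every ε ∈ (a,b) the functions u₁ f and u₂ f^{1/2} are integrable on (ε,b), and that there is a constant A ≥ 0 such that f(ε) ≤ A + ∫_ε^b ( u₁(r) f(r) + u₂(r) f(r)^{1/2} ) dr for all ε ∈ (a,b). Then for all ε ∈ (a,b), f(ε) ≤ { A^{1/2} + (1/2) ∫_ε^b u₂(r) exp( −(1/2) ∫_r^b u₁(τ) dτ ) dr }² · exp( ∫_ε^b u₁(τ) dτ ). -/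
noncomputable section

open MeasureTheory

open Set Filter Topology in
/-- Composing an absolutely continuous function with a Lipschitz one preserves absolute
continuity. -/
theorem LipschitzOnWith.comp_absolutelyContinuousOnInterval {X Y : Type*} [PseudoMetricSpace X]
    [PseudoMetricSpace Y] {f : ℝ → X} {g : X → Y} {s : Set X} {K : NNReal} {a b : ℝ}
    (hg : LipschitzOnWith K g s) (hf : AbsolutelyContinuousOnInterval f a b)
    (hfs : MapsTo f (uIcc a b) s) :
    AbsolutelyContinuousOnInterval (fun x => g (f x)) a b := by
  unfold AbsolutelyContinuousOnInterval at hf ⊢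
  have hK := hf.const_mul (K : ℝ)
  rw [mul_zero] at hK
  refine tendsto_of_tendsto_of_tendsto_of_le_of_le' tendsto_const_nhds hK
    (Eventually.of_forall fun E => Finset.sum_nonneg fun i _ => dist_nonneg) ?_
  filter_upwards [mem_inf_of_right (mem_principal_self _)] with E hE
  rw [Finset.mul_sum]
  exact Finset.sum_le_sum fun i hi =>
    hg.dist_le_mul _ (hfs (hE.1 i hi).1) _ (hfs (hE.1 i hi).2)

open Set in
/-- Composing a real absolutely continuous function with a continuously differentiable one
preserves absolute continuity. -/
theorem AbsolutelyContinuousOnInterval.contDiffOn_comp {f g : ℝ → ℝ} {a b m M : ℝ}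
    (hf : AbsolutelyContinuousOnInterval f a b) (hg : ContDiffOn ℝ 1 g (Icc m M))
    (hfs : MapsTo f (uIcc a b) (Icc m M)) :
    AbsolutelyContinuousOnInterval (fun x => g (f x)) a b := by
  obtain ⟨K, hK⟩ := hg.exists_lipschitzOnWith (by decide) (convex_Icc _ _) isCompact_Icc
  exact hK.comp_absolutelyContinuousOnInterval hf hfs

theorem intervalIntegral_eq_neg_setIntegral_Ioo (g : ℝ → ℝ) {x b : ℝ} (h : x ≤ b) :
    ∫ t in b..x, g t = -∫ t in Set.Ioo x b, g t := by
  rw [intervalIntegral.integral_symm, intervalIntegral.integral_of_le h,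
    integral_Ioc_eq_integral_Ioo]

open Set in
/-- The Gronwall-type estimate for a positive majorant `c + ∫ g`, where
`g ≤ u₁ (c + ∫ g) + u₂ √(c + ∫ g)`. -/
theorem sqrt_mul_exp_le_of_le_mul_add_mul_sqrt {ε b c : ℝ} (hεb : ε ≤ b) (hc : 0 < c)
    {g u₁ u₂ : ℝ → ℝ} (hg : IntegrableOn g (Ioo ε b)) (hu₁ : IntegrableOn u₁ (Ioo ε b))
    (hu₂ : IntegrableOn u₂ (Ioo ε b)) (hg₀ : ∀ x ∈ Ioo ε b, 0 ≤ g x)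
    (hle : ∀ x ∈ Ioo ε b, g x ≤ u₁ x * (c + ∫ t in Ioo x b, g t) +
      u₂ x * √(c + ∫ t in Ioo x b, g t)) :
    √(c + ∫ t in Ioo ε b, g t) * Real.exp (-(1 / 2) * ∫ t in Ioo ε b, u₁ t) ≤
      √c + (1 / 2) * ∫ x in Ioo ε b, u₂ x * Real.exp (-(1 / 2) * ∫ t in Ioo x b, u₁ t) := by
  have hbmem : b ∈ uIcc ε b := right_mem_uIcc
  have hgi := (intervalIntegrable_iff_integrableOn_Ioo_of_le hεb).2 hg
  have hu₁i := (intervalIntegrable_iff_integrableOn_Ioo_of_le hεb).2 hu₁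
  have hu₂i := (intervalIntegrable_iff_integrableOn_Ioo_of_le hεb).2 hu₂
  set G : ℝ → ℝ := fun x => c - ∫ t in b..x, g t with hG
  set ψ : ℝ → ℝ := fun x => (1 / 2) * ∫ t in b..x, u₁ t with hψ
  have hG_eq {x : ℝ} (hx : x ≤ b) : G x = c + ∫ t in Ioo x b, g t := by
    simp [hG, intervalIntegral_eq_neg_setIntegral_Ioo g hx]
  have hψ_eq {x : ℝ} (hx : x ≤ b) : ψ x = -(1 / 2) * ∫ t in Ioo x b, u₁ t := by
    simp [hψ, intervalIntegral_eq_neg_setIntegral_Ioo u₁ hx]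
  have hG_ge {x : ℝ} (hx : x ∈ Icc ε b) : c ≤ G x := by
    rw [hG_eq hx.2]
    have := setIntegral_nonneg (μ := volume) measurableSet_Ioo
      fun t (ht : t ∈ Ioo x b) => hg₀ t ⟨hx.1.trans_lt ht.1, ht.2⟩
    linarith
  have hG_ac : AbsolutelyContinuousOnInterval G ε b :=
    (LipschitzWith.const c).lipschitzOnWith.absolutelyContinuousOnInterval.fun_sub
      (hgi.absolutelyContinuousOnInterval_intervalIntegral hbmem)
  have hψ_ac : AbsolutelyContinuousOnInterval ψ ε b :=
    (hu₁i.absolutelyContinuousOnInterval_intervalIntegral hbmem).const_mul _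
  have hsqrt_ac : AbsolutelyContinuousOnInterval (fun x => √(G x)) ε b := by
    obtain ⟨M, hM⟩ := hG_ac.exists_bound
    refine hG_ac.contDiffOn_comp (m := c) (M := M) (g := Real.sqrt)
      (fun y hy => (Real.contDiffAt_sqrt (hc.trans_le hy.1).ne').contDiffWithinAt)
      fun x hx => ⟨hG_ge (uIcc_of_le hεb ▸ hx), (le_abs_self _).trans (hM x hx)⟩
  have hexp_ac : AbsolutelyContinuousOnInterval (fun x => Real.exp (ψ x)) ε b := by
    obtain ⟨M, hM⟩ := hψ_ac.exists_bound
    exact hψ_ac.contDiffOn_comp (m := -M) (M := M) Real.contDiff_exp.contDiffOn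
      fun x hx => abs_le.1 (hM x hx)
  have hac : AbsolutelyContinuousOnInterval (fun x => √(G x) * Real.exp (ψ x)) ε b :=
    hsqrt_ac.fun_mul hexp_ac
  have hderiv : ∀ᵐ x, x ∈ Ioo ε b →
      -(1 / 2) * (u₂ x * Real.exp (ψ x)) ≤ deriv (fun x => √(G x) * Real.exp (ψ x)) x := by
    filter_upwards [hgi.ae_hasDerivAt_integral, hu₁i.ae_hasDerivAt_integral] with x hgx hux hx
    have hx' : x ∈ uIcc ε b := uIcc_of_le hεb ▸ Ioo_subset_Icc_self hx
    have hGpos : 0 < G x := hc.trans_le (hG_ge (Ioo_subset_Icc_self hx))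
    have hGd : HasDerivAt G (-g x) x := (hgx hx' b hbmem).const_sub c
    have hψd : HasDerivAt ψ ((1 / 2) * u₁ x) x := (hux hx' b hbmem).const_mul _
    rw [((hGd.sqrt hGpos.ne').fun_mul hψd.exp).deriv]
    have hs : 0 < √(G x) := Real.sqrt_pos.2 hGpos
    have hle' := hle x hx
    rw [← hG_eq hx.2.le] at hle'
    have hdiv : g x / (2 * √(G x)) ≤ (1 / 2) * (u₁ x * √(G x) + u₂ x) := by
      rw [div_le_iff₀ (by positivity)]
      linear_combination hle' - u₁ x * Real.mul_self_sqrt hGpos.le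
    have hE := Real.exp_pos (ψ x)
    rw [neg_div]
    nlinarith
  have hint : IntervalIntegrable (fun x => -(1 / 2) * (u₂ x * Real.exp (ψ x))) volume ε b :=
    (hu₂i.mul_continuousOn hexp_ac.continuousOn).const_mul _
  have hmono := intervalIntegral.integral_mono_ae_restrict hεb hint hac.intervalIntegrable_deriv
    (by
      rw [← restrict_Ioo_eq_restrict_Icc]
      exact (ae_restrict_iff' measurableSet_Ioo).2 hderiv)
  rw [hac.integral_deriv_eq_sub, intervalIntegral.integral_const_mul,
    intervalIntegral.integral_of_le hεb, integral_Ioc_eq_integral_Ioo,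
    setIntegral_congr_fun measurableSet_Ioo
      (g := fun x => u₂ x * Real.exp (-(1 / 2) * ∫ t in Ioo x b, u₁ t))
      fun x hx => by simp only [hψ_eq hx.2.le]] at hmono
  have hGb : G b = c := by simp [hG]
  have hψb : ψ b = 0 := by simp [hψ]
  rw [hGb, hψb, hG_eq hεb, hψ_eq hεb, Real.exp_zero] at hmono
  linarith

/-- A Gronwall-type inequality: if a continuous nonnegative function `f`
on `(a,b)` satisfies `f(ε) ≤ A + ∫_ε^b (u₁ f + u₂ √f)` for nonnegative integrable `u₁, u₂`,
then `f(ε) ≤ (√A + ½ ∫_ε^b u₂(r) exp(-½ ∫_r^b u₁))² exp(∫_ε^b u₁)`. -/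
theorem gronwall_type_inequality (a b : ℝ) (hab : a < b)
    (f u₁ u₂ : ℝ → ℝ) (A : ℝ) (hA : 0 ≤ A)
    (hf_cont : ContinuousOn f (Set.Ioo a b))
    (hf_nonneg : ∀ x ∈ Set.Ioo a b, 0 ≤ f x)
    (hu₁_int : IntegrableOn u₁ (Set.Ioo a b))
    (hu₂_int : IntegrableOn u₂ (Set.Ioo a b))
    (hu₁_nonneg : ∀ x ∈ Set.Ioo a b, 0 ≤ u₁ x)
    (hu₂_nonneg : ∀ x ∈ Set.Ioo a b, 0 ≤ u₂ x)
    (hint₁ : ∀ ε ∈ Set.Ioo a b, IntegrableOn (fun r => u₁ r * f r) (Set.Ioo ε b))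
    (hint₂ : ∀ ε ∈ Set.Ioo a b, IntegrableOn (fun r => u₂ r * Real.sqrt (f r)) (Set.Ioo ε b))
    (hbound : ∀ ε ∈ Set.Ioo a b,
      f ε ≤ A + ∫ r in Set.Ioo ε b, (u₁ r * f r + u₂ r * Real.sqrt (f r))) :
    ∀ ε ∈ Set.Ioo a b,
      f ε ≤ (Real.sqrt A +
          (1/2) * ∫ r in Set.Ioo ε b,
            u₂ r * Real.exp (-(1/2) * ∫ τ in Set.Ioo r b, u₁ τ)) ^ 2 *
        Real.exp (∫ τ in Set.Ioo ε b, u₁ τ) := by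
  intro ε hε
  set I := ∫ r in Set.Ioo ε b, u₂ r * Real.exp (-(1/2) * ∫ τ in Set.Ioo r b, u₁ τ) with hI
  set U := ∫ τ in Set.Ioo ε b, u₁ τ with hU
  have hsub {x : ℝ} (hx : x ∈ Set.Ioo ε b) : x ∈ Set.Ioo a b := ⟨hε.1.trans hx.1, hx.2⟩
  have hsubset : Set.Ioo ε b ⊆ Set.Ioo a b := fun _ => hsub
  have key : ∀ δ > 0, √(f ε) * Real.exp (-(1 / 2) * U) ≤ √(A + δ) + (1 / 2) * I := by
    intro δ hδ
    have hmajor {x : ℝ} (hx : x ∈ Set.Ioo a b) :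
        f x ≤ A + δ + ∫ r in Set.Ioo x b, (u₁ r * f r + u₂ r * √(f r)) := by
      linarith [hbound x hx]
    refine le_trans ?_ (sqrt_mul_exp_le_of_le_mul_add_mul_sqrt hε.2.le (by linarith : 0 < A + δ)
      (g := fun r => u₁ r * f r + u₂ r * √(f r)) ((hint₁ ε hε).add (hint₂ ε hε))
      (hu₁_int.mono_set hsubset) (hu₂_int.mono_set hsubset) ?_ ?_)
    · gcongr
      exact hmajor hε
    · intro x hx
      have h₁ := hu₁_nonneg x (hsub hx)
      have h₂ := hu₂_nonneg x (hsub hx)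
      have h₃ := hf_nonneg x (hsub hx)
      positivity
    · intro x hx
      have h₁ := hu₁_nonneg x (hsub hx)
      have h₂ := hu₂_nonneg x (hsub hx)
      have h₃ := hmajor (hsub hx)
      gcongr
  have hlim : √(f ε) * Real.exp (-(1 / 2) * U) ≤ √A + (1 / 2) * I := by
    have hcont : Continuous fun δ : ℝ => √(A + δ) + (1 / 2) * I := by fun_prop
    have ht := (hcont.tendsto 0).mono_left (nhdsWithin_le_nhds (s := Set.Ioi 0))
    rw [add_zero] at ht
    exact ge_of_tendsto ht (Filter.eventually_of_mem self_mem_nhdsWithin key)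
  have hsq := pow_le_pow_left₀ (by positivity) hlim 2
  rw [mul_pow, Real.sq_sqrt (hf_nonneg ε hε), ← Real.exp_nat_mul] at hsq
  calc f ε = f ε * Real.exp ((2 : ℕ) * (-(1 / 2) * U)) * Real.exp U := by
        rw [mul_assoc, ← Real.exp_add]
        push_cast
        ring_nf
        simp
    _ ≤ _ := by gcongr
end
end

section
/- For p > 0 and x > 0 define the generalized Dawson integral D(p,x) = e^{−x^p} ∫₀^x e^{τ^p} dτ. Then for every p ≥ 1 and x > 0 one has D(p,x) ≤ x^{1−p}(1 − e^{−x^p}), and the inequality is strict whenever p > 1. -/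
noncomputable section

open MeasureTheory

/-- The generalized Dawson integral `D(p,x) = e^{-x^p} ∫₀^x e^{τ^p} dτ`. -/
def genDawson (p x : ℝ) : ℝ :=
  Real.exp (-(x ^ p)) * ∫ τ in Set.Ioo 0 x, Real.exp (τ ^ p)

theorem rpow_eq_rpow_sub_one_mul {p t : ℝ} (ht : 0 < t) : t ^ p = t ^ (p - 1) * t := by
  rw [Real.rpow_sub_one ht.ne', div_mul_cancel₀ _ ht.ne']

theorem integral_exp_mul_left {c : ℝ} (hc : c ≠ 0) (x : ℝ) :
    ∫ t in (0 : ℝ)..x, Real.exp (c * t) = c⁻¹ * (Real.exp (c * x) - 1) := by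
  rw [intervalIntegral.integral_comp_mul_left (fun t => Real.exp t) hc]
  simp

theorem continuous_exp_rpow {p : ℝ} (hp : 0 ≤ p) : Continuous fun t : ℝ => Real.exp (t ^ p) :=
  Real.continuous_exp.comp (Real.continuous_rpow_const hp)

theorem exp_rpow_le_exp_mul {p x t : ℝ} (hp : 1 ≤ p) (ht : 0 < t) (htx : t ≤ x) :
    Real.exp (t ^ p) ≤ Real.exp (x ^ (p - 1) * t) := by
  rw [Real.exp_le_exp, rpow_eq_rpow_sub_one_mul ht]
  exact mul_le_mul_of_nonneg_right
    (Real.rpow_le_rpow ht.le htx (sub_nonneg.2 hp)) ht.le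

theorem exp_rpow_lt_exp_mul {p x t : ℝ} (hp : 1 < p) (ht : 0 < t) (htx : t < x) :
    Real.exp (t ^ p) < Real.exp (x ^ (p - 1) * t) := by
  rw [Real.exp_lt_exp, rpow_eq_rpow_sub_one_mul ht]
  exact mul_lt_mul_of_pos_right (Real.rpow_lt_rpow ht.le htx (sub_pos.2 hp)) ht

theorem genDawson_eq_intervalIntegral (p : ℝ) {x : ℝ} (hx : 0 ≤ x) :
    genDawson p x = Real.exp (-(x ^ p)) * ∫ t in (0 : ℝ)..x, Real.exp (t ^ p) := by
  rw [genDawson, intervalIntegral.integral_of_le hx, integral_Ioc_eq_integral_Ioo]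

theorem rpow_mul_one_sub_exp_eq (p : ℝ) {x : ℝ} (hx : 0 < x) :
    x ^ (1 - p) * (1 - Real.exp (-(x ^ p))) =
      Real.exp (-(x ^ p)) * ∫ t in (0 : ℝ)..x, Real.exp (x ^ (p - 1) * t) := by
  rw [integral_exp_mul_left (Real.rpow_pos_of_pos hx _).ne', ← rpow_eq_rpow_sub_one_mul hx,
    ← Real.rpow_neg hx.le, neg_sub, mul_left_comm, mul_sub (Real.exp _), ← Real.exp_add]
  simp

/-- For `p ≥ 1` and `x > 0`, `D(p,x) ≤ x^{1-p} (1 - e^{-x^p})`,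
with strict inequality whenever `p > 1`. -/
theorem genDawson_le (p x : ℝ) (hp : 1 ≤ p) (hx : 0 < x) :
    genDawson p x ≤ x ^ (1 - p) * (1 - Real.exp (-(x ^ p))) ∧
      (1 < p → genDawson p x < x ^ (1 - p) * (1 - Real.exp (-(x ^ p)))) := by
  have hf : Continuous fun t : ℝ => Real.exp (t ^ p) :=
    continuous_exp_rpow (zero_le_one.trans hp)
  have hg : Continuous fun t : ℝ => Real.exp (x ^ (p - 1) * t) := by fun_prop
  rw [genDawson_eq_intervalIntegral p hx.le, rpow_mul_one_sub_exp_eq p hx]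
  refine ⟨mul_le_mul_of_nonneg_left ?_ (Real.exp_pos _).le,
    fun hp' => mul_lt_mul_of_pos_left ?_ (Real.exp_pos _)⟩
  · exact intervalIntegral.integral_mono_on_of_le_Ioo hx.le (hf.intervalIntegrable _ _)
      (hg.intervalIntegrable _ _) fun t ht => exp_rpow_le_exp_mul hp ht.1 ht.2.le
  · exact intervalIntegral.integral_lt_integral_of_continuousOn_of_le_of_exists_lt hx
      hf.continuousOn hg.continuousOn (fun t ht => exp_rpow_le_exp_mul hp ht.1 ht.2)
      ⟨x / 2, ⟨(half_pos hx).le, (half_lt_self hx).le⟩,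
        exp_rpow_lt_exp_mul hp' (half_pos hx) (half_lt_self hx)⟩
end
end

section
/- (A Hadamard three-line theorem with linear growth on one boundary line.) Let S = { ζ ∈ ℂ : 0 < Re ζ < 1 } and let F be continuous on the closed strip S̄, holomorphic on S, and suppose there is K > 0 such that |F(ζ)| ≤ K(1 + |Im ζ|) for all ζ ∈ S̄. Assume there are M₀, M₁ > 0 with sup_{b ∈ ℝ} |F(i b)| ≤ M₀ and sup_{b ∈ ℝ} (1 + |b|)^{−1} |F(1 + i b)| ≤ M₁. Then for every ζ = a + i b ∈ S (0 < a < 1), |F(ζ)| ≤ |1 + √2 ζ| · M₀^{1−a} M₁^{a}. -/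
noncomputable section

open Complex in
theorem norm_sq_one_add_sqrt_two_mul (z : ℂ) :
    ‖1 + (Real.sqrt 2 : ℂ) * z‖ ^ 2 = (1 + √2 * z.re) ^ 2 + 2 * z.im ^ 2 := by
  rw [Complex.sq_norm, normSq_apply]
  simp only [add_re, one_re, re_ofReal_mul, add_im, one_im, im_ofReal_mul]
  linear_combination z.im ^ 2 * Real.sq_sqrt (show (0 : ℝ) ≤ 2 by norm_num)

theorem one_le_norm_one_add_sqrt_two_mul {z : ℂ} (hz : 0 ≤ z.re) :
    1 ≤ ‖1 + (Real.sqrt 2 : ℂ) * z‖ := by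
  refine (sq_le_sq₀ (by positivity) (norm_nonneg _)).1 ?_
  rw [norm_sq_one_add_sqrt_two_mul]
  nlinarith [mul_nonneg (Real.sqrt_nonneg 2) hz, sq_nonneg z.im]

theorem one_add_abs_im_le_two_mul_norm {z : ℂ} (hz : 0 ≤ z.re) :
    1 + |z.im| ≤ 2 * ‖1 + (Real.sqrt 2 : ℂ) * z‖ := by
  refine (sq_le_sq₀ (by positivity) (by positivity)).1 ?_
  rw [mul_pow, norm_sq_one_add_sqrt_two_mul]
  nlinarith [mul_nonneg (Real.sqrt_nonneg 2) hz, sq_abs z.im, sq_nonneg (|z.im| - 1)]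

theorem one_add_abs_im_le_norm_of_re_eq_one {z : ℂ} (hz : z.re = 1) :
    1 + |z.im| ≤ ‖1 + (Real.sqrt 2 : ℂ) * z‖ := by
  refine (sq_le_sq₀ (by positivity) (norm_nonneg _)).1 ?_
  rw [norm_sq_one_add_sqrt_two_mul, hz]
  nlinarith [Real.sqrt_nonneg 2, Real.sq_sqrt (show (0 : ℝ) ≤ 2 by norm_num), sq_abs z.im,
    sq_nonneg (|z.im| - 1)]

/-- A Hadamard three-line theorem with linear growth on one boundary line:
if `F` is continuous on the closed strip `0 ≤ Re ζ ≤ 1`, holomorphic in the open strip,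
satisfies `|F(ζ)| ≤ K(1 + |Im ζ|)` on the closed strip, `|F(ib)| ≤ M₀` and
`|F(1+ib)| ≤ M₁ (1+|b|)` for all real `b`, then `|F(ζ)| ≤ |1 + √2 ζ| M₀^{1-Re ζ} M₁^{Re ζ}`
in the open strip. -/
theorem hadamard_three_lines_linear_growth (F : ℂ → ℂ) (K M₀ M₁ : ℝ)
    (hK : 0 < K) (hM₀ : 0 < M₀) (hM₁ : 0 < M₁)
    (hcont : ContinuousOn F {ζ : ℂ | 0 ≤ ζ.re ∧ ζ.re ≤ 1})
    (hholo : ∀ ζ ∈ {ζ : ℂ | 0 < ζ.re ∧ ζ.re < 1}, DifferentiableAt ℂ F ζ)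
    (hgrow : ∀ ζ : ℂ, 0 ≤ ζ.re → ζ.re ≤ 1 → ‖F ζ‖ ≤ K * (1 + |ζ.im|))
    (h0 : ∀ b : ℝ, ‖F (Complex.I * (b : ℂ))‖ ≤ M₀)
    (h1 : ∀ b : ℝ, ‖F (1 + Complex.I * (b : ℂ))‖ ≤ M₁ * (1 + |b|)) :
    ∀ ζ : ℂ, 0 < ζ.re → ζ.re < 1 →
      ‖F ζ‖ ≤ ‖1 + (Real.sqrt 2 : ℂ) * ζ‖ * M₀ ^ (1 - ζ.re) * M₁ ^ ζ.re := by
  intro ζ hζ0 hζ1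
  have hpos {z : ℂ} (hz : 0 ≤ z.re) : 0 < ‖1 + (Real.sqrt 2 : ℂ) * z‖ :=
    one_pos.trans_le (one_le_norm_one_add_sqrt_two_mul hz)
  have hclosure : closure (Complex.HadamardThreeLines.verticalStrip 0 1) =
      {z : ℂ | 0 ≤ z.re ∧ z.re ≤ 1} := by
    rw [Complex.HadamardThreeLines.verticalStrip, Complex.closure_preimage_re,
      closure_Ioo zero_ne_one]
    rfl
  have hd : DiffContOnCl ℂ (fun z ↦ F z / (1 + (Real.sqrt 2 : ℂ) * z))
      (Complex.HadamardThreeLines.verticalStrip 0 1) := by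
    refine ⟨fun z hz ↦ ?_, ?_⟩
    · exact ((hholo z hz).div (by fun_prop)
        (norm_pos_iff.1 (hpos hz.1.le))).differentiableWithinAt
    · rw [hclosure]
      exact hcont.div (by fun_prop) fun z hz ↦ norm_pos_iff.1 (hpos hz.1)
  have hB : BddAbove ((norm ∘ fun z ↦ F z / (1 + (Real.sqrt 2 : ℂ) * z)) ''
      Complex.HadamardThreeLines.verticalClosedStrip 0 1) := by
    refine ⟨K * 2, ?_⟩
    rintro _ ⟨z, hz, rfl⟩
    rw [Function.comp_apply, norm_div, div_le_iff₀ (hpos hz.1), mul_assoc]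
    exact (hgrow z hz.1 hz.2).trans
      (mul_le_mul_of_nonneg_left (one_add_abs_im_le_two_mul_norm hz.1) hK.le)
  have key := Complex.HadamardThreeLines.norm_le_interp_of_mem_verticalClosedStrip₀₁' _
    (a := M₀) (b := M₁) (z := ζ) ⟨hζ0.le, hζ1.le⟩ hd hB ?_ ?_
  · rw [norm_div, div_le_iff₀ (hpos hζ0.le)] at key
    linarith
  · intro z (hz : z.re = 0)
    rw [norm_div, div_le_iff₀ (hpos hz.ge)]
    have hzI : Complex.I * (z.im : ℂ) = z := by apply Complex.ext <;> simp [hz]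
    have hF := h0 z.im
    rw [hzI] at hF
    exact hF.trans (le_mul_of_one_le_right hM₀.le (one_le_norm_one_add_sqrt_two_mul hz.ge))
  · intro z (hz : z.re = 1)
    rw [norm_div, div_le_iff₀ (hpos (hz ▸ zero_le_one))]
    have hzI : 1 + Complex.I * (z.im : ℂ) = z := by apply Complex.ext <;> simp [hz]
    have hF := h1 z.im
    rw [hzI] at hF
    exact hF.trans
      (mul_le_mul_of_nonneg_left (one_add_abs_im_le_norm_of_re_eq_one hz) hM₁.le)
end
end

section
/- Let 0 < μ ≤ 1 and write ⟨x⟩ = (1+x²)^{1/2} for x ∈ ℝ. Then for all λ ∈ ℝ: (i) ⟨λ⟩^{−μ} ⟨ελ⟩^{μ−1} ≤ 1 for every ε ≥ 0; (ii) ε λ² ⟨λ⟩^{−μ} ⟨ελ⟩^{μ−3} ≤ ε^{μ−1} for every ε > 0; (iii) |λ| ⟨λ⟩^{−μ} ⟨ελ⟩^{μ−1} ≤ ε^{μ−1} for every ε > 0. -/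
noncomputable section

/-- The Japanese bracket `⟨x⟩ = (1 + x²)^{1/2}` of a real number. -/
def jbracket (x : ℝ) : ℝ := Real.sqrt (1 + x ^ 2)

theorem one_le_jbracket (x : ℝ) : 1 ≤ jbracket x :=
  Real.one_le_sqrt.2 (le_add_of_nonneg_right (sq_nonneg x))

theorem jbracket_pos (x : ℝ) : 0 < jbracket x :=
  zero_lt_one.trans_le (one_le_jbracket x)

theorem abs_le_jbracket (x : ℝ) : |x| ≤ jbracket x :=
  Real.abs_le_sqrt (le_add_of_nonneg_left zero_le_one)

theorem abs_mul_jbracket_rpow_le {μ : ℝ} (hμ0 : 0 ≤ μ) (hμ1 : μ ≤ 1) (l : ℝ) {ε : ℝ}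
    (hε : 0 < ε) :
    |l| * jbracket l ^ (-μ) * jbracket (ε * l) ^ (μ - 1) ≤ ε ^ (μ - 1) := by
  rcases eq_or_ne l 0 with rfl | hl
  · simpa using Real.rpow_nonneg hε.le (μ - 1)
  have hl : 0 < |l| := abs_pos.2 hl
  have h₁ : jbracket l ^ (-μ) ≤ |l| ^ (-μ) :=
    Real.rpow_le_rpow_of_nonpos hl (abs_le_jbracket l) (neg_nonpos.2 hμ0)
  have h₂ : jbracket (ε * l) ^ (μ - 1) ≤ (ε * |l|) ^ (μ - 1) := by
    refine Real.rpow_le_rpow_of_nonpos (mul_pos hε hl) ?_ (sub_nonpos.2 hμ1)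
    simpa [abs_mul, abs_of_pos hε] using abs_le_jbracket (ε * l)
  have h₃ : |l| * |l| ^ (-μ) * |l| ^ (μ - 1) = 1 := by
    nth_rw 1 [← Real.rpow_one |l|]
    rw [← Real.rpow_add hl, ← Real.rpow_add hl, show 1 + -μ + (μ - 1) = 0 by ring, Real.rpow_zero]
  calc |l| * jbracket l ^ (-μ) * jbracket (ε * l) ^ (μ - 1)
      ≤ |l| * |l| ^ (-μ) * (ε * |l|) ^ (μ - 1) :=
        mul_le_mul (mul_le_mul_of_nonneg_left h₁ hl.le) h₂
          (Real.rpow_nonneg (jbracket_pos _).le _) (by positivity)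
    _ = |l| * |l| ^ (-μ) * |l| ^ (μ - 1) * ε ^ (μ - 1) := by
        rw [Real.mul_rpow hε.le hl.le]; ring
    _ = ε ^ (μ - 1) := by rw [h₃, one_mul]

/-- For `0 < μ ≤ 1` and all real `λ`:
(i) `⟨λ⟩^{-μ} ⟨ελ⟩^{μ-1} ≤ 1` for every `ε ≥ 0`;
(ii) `ε λ² ⟨λ⟩^{-μ} ⟨ελ⟩^{μ-3} ≤ ε^{μ-1}` for every `ε > 0`;
(iii) `|λ| ⟨λ⟩^{-μ} ⟨ελ⟩^{μ-1} ≤ ε^{μ-1}` for every `ε > 0`. -/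
theorem jbracket_weight_bounds (μ : ℝ) (hμ0 : 0 < μ) (hμ1 : μ ≤ 1) (l : ℝ) :
    (∀ ε : ℝ, 0 ≤ ε → jbracket l ^ (-μ) * jbracket (ε * l) ^ (μ - 1) ≤ 1) ∧
    (∀ ε : ℝ, 0 < ε →
      ε * l ^ 2 * jbracket l ^ (-μ) * jbracket (ε * l) ^ (μ - 3) ≤ ε ^ (μ - 1)) ∧
    (∀ ε : ℝ, 0 < ε →
      |l| * jbracket l ^ (-μ) * jbracket (ε * l) ^ (μ - 1) ≤ ε ^ (μ - 1)) := by
  refine ⟨fun ε _ ↦ ?_, fun ε hε ↦ ?_, fun ε hε ↦ abs_mul_jbracket_rpow_le hμ0.le hμ1 l hε⟩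
  · exact mul_le_one₀
      (Real.rpow_le_one_of_one_le_of_nonpos (one_le_jbracket l) (neg_nonpos.2 hμ0.le))
      (Real.rpow_nonneg (jbracket_pos _).le _)
      (Real.rpow_le_one_of_one_le_of_nonpos (one_le_jbracket _) (sub_nonpos.2 hμ1))
  · have hB : 0 < jbracket (ε * l) := jbracket_pos _
    have hle : ε * |l| / jbracket (ε * l) ^ 2 ≤ 1 := by
      rw [div_le_one (pow_pos hB 2)]
      calc ε * |l| = |ε * l| := by rw [abs_mul, abs_of_pos hε]
        _ ≤ jbracket (ε * l) := abs_le_jbracket _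
        _ ≤ jbracket (ε * l) ^ 2 := le_self_pow₀ (one_le_jbracket _) two_ne_zero
    have hpow : jbracket (ε * l) ^ (μ - 3) =
        jbracket (ε * l) ^ (μ - 1) / jbracket (ε * l) ^ 2 := by
      rw [← Real.rpow_natCast, ← Real.rpow_sub hB]
      norm_num [sub_sub]
    calc ε * l ^ 2 * jbracket l ^ (-μ) * jbracket (ε * l) ^ (μ - 3)
        = |l| * jbracket l ^ (-μ) * jbracket (ε * l) ^ (μ - 1) *
            (ε * |l| / jbracket (ε * l) ^ 2) := by
          rw [hpow, ← sq_abs l]; ring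
      _ ≤ ε ^ (μ - 1) * 1 := by
          refine mul_le_mul (abs_mul_jbracket_rpow_le hμ0.le hμ1 l hε) hle ?_ ?_ <;> positivity
      _ = ε ^ (μ - 1) := mul_one _
end
end

section
/- (Hardy-type inequality on the Heisenberg group with the Koranyi weight.) Let d ≥ 1. For every f ∈ 𝒮(ℝ^{2d+1}), ∫_{ℝ^{2d+1}} |z|² (|z|⁴ + t²)^{−1} |f(z,t)|² dz dt ≤ d^{−2} ∫_{ℝ^{2d+1}} |∇_H f(z,t)|² dz dt. -/
noncomputable section

open MeasureTheory ENNReal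

open scoped SchwartzMap

/-- The integral of a directional derivative of a Schwartz function vanishes. -/
theorem SchwartzMap.integral_fderiv_apply_eq_zero {E : Type*} [NormedAddCommGroup E]
    [NormedSpace ℝ E] [FiniteDimensional ℝ E] [MeasurableSpace E] [BorelSpace E]
    (μ : Measure E) [μ.IsAddHaarMeasure] (g : 𝓢(E, ℝ)) (v : E) :
    ∫ p, fderiv ℝ g p v ∂μ = 0 := by
  have hg' : Integrable (fun p => fderiv ℝ g p v) μ :=
    (LineDeriv.lineDerivOp v g).integrable
  simpa using integral_mul_fderiv_eq_neg_fderiv_mul_of_integrable (μ := μ) (𝕜 := ℝ)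
    (f := fun _ => 1) (g := g) (v := v) (by simp) (by simpa using hg')
    (by simpa using g.integrable) (fun _ _ => differentiableAt_const _)
    (fun p _ => g.differentiableAt)

theorem SchwartzMap.integrable_fderiv_apply {E : Type*} [NormedAddCommGroup E]
    [NormedSpace ℝ E] [FiniteDimensional ℝ E] [MeasurableSpace E] [BorelSpace E]
    (μ : Measure E) [μ.IsAddHaarMeasure] (g : 𝓢(E, ℝ)) (v : E) :
    Integrable (fun p => fderiv ℝ g p v) μ :=
  (LineDeriv.lineDerivOp v g).integrable

namespace Heisenberg

variable {d : ℕ}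

instance : (volume : Measure (Hd d)).IsAddHaarMeasure :=
  haveI : (volume : Measure (EuclideanSpace ℝ (Fin d) × ℝ)).IsAddHaarMeasure :=
    Measure.prod.instIsAddHaarMeasure _ _
  Measure.prod.instIsAddHaarMeasure _ _

/-- The regularized weight `(ε + |z|⁴ + t²)⁻¹`. -/
def regWeight (d : ℕ) (ε : ℝ) (p : Hd d) : ℝ := (ε + zsq d p ^ 2 + p.2.2 ^ 2)⁻¹

/-- The projection `(x, y, t) ↦ x` as a continuous linear map. -/
def xproj (d : ℕ) : Hd d →L[ℝ] EuclideanSpace ℝ (Fin d) := ContinuousLinearMap.fst ℝ _ _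

/-- The projection `(x, y, t) ↦ y` as a continuous linear map. -/
def yproj (d : ℕ) : Hd d →L[ℝ] EuclideanSpace ℝ (Fin d) :=
  (ContinuousLinearMap.fst ℝ _ _).comp (ContinuousLinearMap.snd ℝ _ _)

/-- The coordinate `x_j` as a continuous linear map. -/
def xcoord (j : Fin d) : Hd d →L[ℝ] ℝ :=
  (EuclideanSpace.proj j).comp (xproj d)

/-- The coordinate `y_j` as a continuous linear map. -/
def ycoord (j : Fin d) : Hd d →L[ℝ] ℝ :=
  (EuclideanSpace.proj j).comp (yproj d)

/-- The coordinate `t` as a continuous linear map. -/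
def tcoord (d : ℕ) : Hd d →L[ℝ] ℝ :=
  (ContinuousLinearMap.snd ℝ _ _).comp (ContinuousLinearMap.snd ℝ _ _)

@[simp] theorem xcoord_apply (j : Fin d) (p : Hd d) : xcoord j p = p.1 j := rfl

@[simp] theorem ycoord_apply (j : Fin d) (p : Hd d) : ycoord j p = p.2.1 j := rfl

@[simp] theorem tcoord_apply (p : Hd d) : tcoord d p = p.2.2 := rfl

theorem hasTemperateGrowth_zsq : (zsq d).HasTemperateGrowth :=
  ((Function.hasTemperateGrowth_norm_sq (EuclideanSpace ℝ (Fin d))).comp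
    (xproj d).hasTemperateGrowth).add
    ((Function.hasTemperateGrowth_norm_sq (EuclideanSpace ℝ (Fin d))).comp
      (yproj d).hasTemperateGrowth)

theorem hasTemperateGrowth_regWeight {ε : ℝ} (hε : 0 < ε) :
    (regWeight d ε).HasTemperateGrowth := by
  have hL : (fun p : Hd d => (√ε)⁻¹ • ((zsq d p : ℂ) + p.2.2 * Complex.I)).HasTemperateGrowth := by
    have h1 := Function.Complex.hasTemperateGrowth_ofReal.comp (hasTemperateGrowth_zsq (d := d))
    have h2 := Function.Complex.hasTemperateGrowth_ofReal.comp ((tcoord d).hasTemperateGrowth)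
    exact (Function.HasTemperateGrowth.const (√ε)⁻¹).smul
      (h1.add (h2.mul (Function.HasTemperateGrowth.const Complex.I)))
  have h := (Function.HasTemperateGrowth.const ε⁻¹).mul
    ((Function.hasTemperateGrowth_one_add_norm_sq_rpow ℂ (-1)).comp hL)
  refine (congrArg Function.HasTemperateGrowth (funext fun p => ?_)).mpr h
  have hn : ‖(zsq d p : ℂ) + p.2.2 * Complex.I‖ ^ 2 = zsq d p ^ 2 + p.2.2 ^ 2 := by
    rw [← Complex.normSq_eq_norm_sq, Complex.normSq_add_mul_I]
  simp only [Pi.mul_apply, Function.comp_apply, norm_smul, mul_pow, hn, Real.rpow_neg_one,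
    norm_inv, inv_pow, Real.norm_eq_abs, sq_abs, Real.sq_sqrt hε.le, regWeight]
  rw [← mul_inv]
  congr 1
  field_simp
  ring

/-- The `X_j`-component `(|z|² x_j + t y_j)(ε + |z|⁴ + t²)⁻¹` of the regularized horizontal
gradient of the logarithm of the Koranyi norm. -/
def fieldX (ε : ℝ) (j : Fin d) (p : Hd d) : ℝ :=
  (zsq d p * p.1 j + p.2.2 * p.2.1 j) * regWeight d ε p

/-- The `Y_j`-component `(|z|² y_j - t x_j)(ε + |z|⁴ + t²)⁻¹` of the regularized horizontal
gradient of the logarithm of the Koranyi norm. -/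
def fieldY (ε : ℝ) (j : Fin d) (p : Hd d) : ℝ :=
  (zsq d p * p.2.1 j - p.2.2 * p.1 j) * regWeight d ε p

theorem hasTemperateGrowth_fieldX {ε : ℝ} (hε : 0 < ε) (j : Fin d) :
    (fieldX ε j).HasTemperateGrowth :=
  ((hasTemperateGrowth_zsq.mul (xcoord j).hasTemperateGrowth).add
    ((tcoord d).hasTemperateGrowth.mul (ycoord j).hasTemperateGrowth)).mul
    (hasTemperateGrowth_regWeight hε)

theorem hasTemperateGrowth_fieldY {ε : ℝ} (hε : 0 < ε) (j : Fin d) :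
    (fieldY ε j).HasTemperateGrowth :=
  ((hasTemperateGrowth_zsq.mul (ycoord j).hasTemperateGrowth).sub
    ((tcoord d).hasTemperateGrowth.mul (xcoord j).hasTemperateGrowth)).mul
    (hasTemperateGrowth_regWeight hε)

theorem fderiv_zsq (p v : Hd d) :
    fderiv ℝ (zsq d) p v = 2 * inner ℝ p.1 v.1 + 2 * inner ℝ p.2.1 v.2.1 := by
  have h : HasFDerivAt (zsq d) _ p :=
    (xproj d).hasFDerivAt.norm_sq.add (yproj d).hasFDerivAt.norm_sq
  rw [h.fderiv]
  simp [xproj, yproj]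

theorem _root_.Function.HasTemperateGrowth.differentiableAt {E F : Type*} [NormedAddCommGroup E]
    [NormedSpace ℝ E] [NormedAddCommGroup F] [NormedSpace ℝ F] {g : E → F}
    (hg : g.HasTemperateGrowth) (p : E) : DifferentiableAt ℝ g p :=
  hg.1.differentiable (by simp) p

theorem fderiv_regWeight {ε : ℝ} (hε : 0 < ε) (p v : Hd d) :
    fderiv ℝ (regWeight d ε) p v =
      -(2 * zsq d p * fderiv ℝ (zsq d) p v + 2 * p.2.2 * v.2.2) * regWeight d ε p ^ 2 := by
  have hN : ε + zsq d p ^ 2 + p.2.2 ^ 2 ≠ 0 := by positivity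
  have h : HasFDerivAt (regWeight d ε) _ p :=
    (hasDerivAt_inv hN).comp_hasFDerivAt p
      ((((hasTemperateGrowth_zsq.differentiableAt p).hasFDerivAt.pow 2).const_add ε).add
        ((tcoord d).hasFDerivAt.pow 2))
  rw [h.fderiv]
  simp [regWeight]
  ring

theorem fderiv_mul_apply {E : Type*} [NormedAddCommGroup E] [NormedSpace ℝ E] {g h : E → ℝ}
    {p : E} (hg : DifferentiableAt ℝ g p) (hh : DifferentiableAt ℝ h p) (v : E) :
    fderiv ℝ (fun q => g q * h q) p v = g p * fderiv ℝ h p v + h p * fderiv ℝ g p v := by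
  rw [fderiv_fun_mul hg hh]; simp

theorem fderiv_fieldX {ε : ℝ} (hε : 0 < ε) (j : Fin d) (p v : Hd d) :
    fderiv ℝ (fieldX ε j) p v =
      (zsq d p * v.1 j + p.1 j * fderiv ℝ (zsq d) p v + p.2.2 * v.2.1 j + p.2.1 j * v.2.2) *
        regWeight d ε p +
      (zsq d p * p.1 j + p.2.2 * p.2.1 j) * fderiv ℝ (regWeight d ε) p v := by
  have h : HasFDerivAt (fieldX ε j) _ p :=
    (((hasTemperateGrowth_zsq.differentiableAt p).hasFDerivAt.mul (xcoord j).hasFDerivAt).add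
      ((tcoord d).hasFDerivAt.mul (ycoord j).hasFDerivAt)).mul
      ((hasTemperateGrowth_regWeight hε).differentiableAt p).hasFDerivAt
  rw [h.fderiv]
  simp
  ring

theorem fderiv_fieldY {ε : ℝ} (hε : 0 < ε) (j : Fin d) (p v : Hd d) :
    fderiv ℝ (fieldY ε j) p v =
      (zsq d p * v.2.1 j + p.2.1 j * fderiv ℝ (zsq d) p v - p.2.2 * v.1 j - p.1 j * v.2.2) *
        regWeight d ε p +
      (zsq d p * p.2.1 j - p.2.2 * p.1 j) * fderiv ℝ (regWeight d ε) p v := by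
  have h : HasFDerivAt (fieldY ε j) _ p :=
    (((hasTemperateGrowth_zsq.differentiableAt p).hasFDerivAt.mul (ycoord j).hasFDerivAt).sub
      ((tcoord d).hasFDerivAt.mul (xcoord j).hasFDerivAt)).mul
      ((hasTemperateGrowth_regWeight hε).differentiableAt p).hasFDerivAt
  rw [h.fderiv]
  simp
  ring

/-- The direction of the vector field `X_j` at `p`. -/
def dirX (j : Fin d) (p : Hd d) : Hd d := (EuclideanSpace.single j 1, 0, 2 * p.2.1 j)

/-- The direction of the vector field `Y_j` at `p`. -/
def dirY (j : Fin d) (p : Hd d) : Hd d := (0, EuclideanSpace.single j 1, -(2 * p.1 j))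

theorem fderiv_fieldX_add_fderiv_fieldY {ε : ℝ} (hε : 0 < ε) (j : Fin d) (p : Hd d) :
    fderiv ℝ (fieldX ε j) p (dirX j p) + fderiv ℝ (fieldY ε j) p (dirY j p) =
      (2 * zsq d p + 4 * (p.1 j ^ 2 + p.2.1 j ^ 2)) * regWeight d ε p -
      4 * (zsq d p ^ 2 + p.2.2 ^ 2) * regWeight d ε p ^ 2 * (p.1 j ^ 2 + p.2.1 j ^ 2) := by
  rw [fderiv_fieldX hε, fderiv_fieldY hε, fderiv_regWeight hε, fderiv_regWeight hε]
  simp only [fderiv_zsq, dirX, dirY]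
  simp [EuclideanSpace.inner_single_right]
  ring

theorem fieldX_sq_add_fieldY_sq (ε : ℝ) (j : Fin d) (p : Hd d) :
    fieldX ε j p ^ 2 + fieldY ε j p ^ 2 =
      (zsq d p ^ 2 + p.2.2 ^ 2) * regWeight d ε p ^ 2 * (p.1 j ^ 2 + p.2.1 j ^ 2) := by
  simp only [fieldX, fieldY]
  ring

theorem zsq_nonneg (p : Hd d) : 0 ≤ zsq d p := by unfold zsq; positivity

theorem regWeight_nonneg {ε : ℝ} (hε : 0 < ε) (p : Hd d) : 0 ≤ regWeight d ε p := by
  unfold regWeight; positivity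

theorem mul_regWeight_sq_le {ε : ℝ} (hε : 0 < ε) (p : Hd d) :
    (zsq d p ^ 2 + p.2.2 ^ 2) * regWeight d ε p ^ 2 ≤ regWeight d ε p := by
  have hr := regWeight_nonneg hε p
  have h : regWeight d ε p * (ε + zsq d p ^ 2 + p.2.2 ^ 2) = 1 :=
    inv_mul_cancel₀ (by positivity)
  nlinarith [mul_nonneg hε.le (sq_nonneg (regWeight d ε p)), congrArg (regWeight d ε p * ·) h]

theorem sum_sq_eq_zsq (p : Hd d) : ∑ j, (p.1 j ^ 2 + p.2.1 j ^ 2) = zsq d p := by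
  simp [zsq, EuclideanSpace.real_norm_sq_eq, Finset.sum_add_distrib]

/-- The squared modulus of a Schwartz function, as a Schwartz function. -/
def normSq (f : 𝓢(Hd d, ℂ)) : 𝓢(Hd d, ℝ) :=
  SchwartzMap.bilinLeftCLM (innerSL ℝ) f.hasTemperateGrowth f

theorem normSq_apply (f : 𝓢(Hd d, ℂ)) (p : Hd d) : normSq f p = ‖f p‖ ^ 2 := by
  exact real_inner_self_eq_norm_sq (f p)

theorem fderiv_normSq (f : 𝓢(Hd d, ℂ)) (p v : Hd d) :
    fderiv ℝ (normSq f) p v = 2 * inner ℝ (f p) (fderiv ℝ f p v) := by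
  have h : HasFDerivAt (fun q => ‖f q‖ ^ 2) _ p := (f.hasFDerivAt p).norm_sq
  have he : (normSq f : Hd d → ℝ) = fun q => ‖f q‖ ^ 2 := funext (normSq_apply f)
  rw [he, h.fderiv, smul_apply, ContinuousLinearMap.comp_apply,
    innerSL_apply_apply, nsmul_eq_mul, Nat.cast_ofNat]

/-- Multiplication of a Schwartz function by a function of temperate growth. -/
theorem exists_schwartz_mul {g : Hd d → ℝ} (hg : g.HasTemperateGrowth) (u : 𝓢(Hd d, ℝ)) :
    ∃ w : 𝓢(Hd d, ℝ), (w : Hd d → ℝ) = fun p => g p * u p :=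
  ⟨SchwartzMap.smulLeftCLM ℝ g u, by simp [SchwartzMap.smulLeftCLM_apply hg]⟩

/-- If `g` does not depend on `t`, the field `∂_a + g ∂_t` is divergence free. -/
theorem integral_fderiv_dir {g : Hd d →L[ℝ] ℝ} (hg : g (0, 0, 1) = 0) (a : Hd d)
    (u : 𝓢(Hd d, ℝ)) :
    Integrable (fun p => fderiv ℝ u p (a + g p • (0, 0, 1))) ∧
      ∫ p, fderiv ℝ u p (a + g p • (0, 0, 1)) = 0 := by
  obtain ⟨w, hw⟩ := exists_schwartz_mul g.hasTemperateGrowth u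
  have he : ∀ p, fderiv ℝ u p (a + g p • (0, 0, 1)) =
      fderiv ℝ u p a + fderiv ℝ w p (0, 0, 1) := fun p => by
    rw [hw, fderiv_mul_apply g.differentiableAt u.differentiableAt,
      map_add, map_smul, g.fderiv, hg, smul_eq_mul, mul_zero, add_zero]
  simp only [he]
  have h1 := SchwartzMap.integrable_fderiv_apply volume u a
  have h2 := SchwartzMap.integrable_fderiv_apply volume w (0, 0, 1)
  refine ⟨h1.add h2, ?_⟩
  rw [integral_add h1 h2, SchwartzMap.integral_fderiv_apply_eq_zero,
    SchwartzMap.integral_fderiv_apply_eq_zero, add_zero]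

theorem integral_fderiv_dirX (j : Fin d) (u : 𝓢(Hd d, ℝ)) :
    Integrable (fun p => fderiv ℝ u p (dirX j p)) ∧ ∫ p, fderiv ℝ u p (dirX j p) = 0 := by
  have h := integral_fderiv_dir (g := (2 : ℝ) • ycoord j) (by simp)
    (EuclideanSpace.single j 1, 0, 0) u
  simpa [dirX] using h

theorem integral_fderiv_dirY (j : Fin d) (u : 𝓢(Hd d, ℝ)) :
    Integrable (fun p => fderiv ℝ u p (dirY j p)) ∧ ∫ p, fderiv ℝ u p (dirY j p) = 0 := by
  have h := integral_fderiv_dir (g := (-2 : ℝ) • xcoord j) (by simp)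
    (0, EuclideanSpace.single j 1, 0) u
  simpa [dirY] using h

theorem norm_sq_add_mul_nonneg (z w : ℂ) (c : ℝ) :
    0 ≤ ‖w‖ ^ 2 + 2 * c * inner ℝ z w + c ^ 2 * ‖z‖ ^ 2 := by
  have h := sq_nonneg ‖w + c • z‖
  rw [norm_add_sq_real, inner_smul_right, norm_smul, mul_pow, Real.norm_eq_abs, sq_abs,
    real_inner_comm] at h
  linarith

theorem pointwise_hardy {ε : ℝ} (hε : 0 < ε) (f : 𝓢(Hd d, ℂ)) (p : Hd d) :
    (d : ℝ) ^ 2 * (zsq d p * regWeight d ε p * ‖f p‖ ^ 2) ≤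
      gradHsq d f p + d * ∑ j : Fin d,
        (fderiv ℝ (fun q => fieldX ε j q * normSq f q) p (dirX j p) +
          fderiv ℝ (fun q => fieldY ε j q * normSq f q) p (dirY j p)) := by
  have key : ∀ j : Fin d,
      2 * d * (zsq d p * regWeight d ε p * ‖f p‖ ^ 2) -
        d ^ 2 * (regWeight d ε p * ‖f p‖ ^ 2) * (p.1 j ^ 2 + p.2.1 j ^ 2) ≤
      (‖Xop d j f p‖ ^ 2 + ‖Yop d j f p‖ ^ 2) + d *
        (fderiv ℝ (fun q => fieldX ε j q * normSq f q) p (dirX j p) +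
          fderiv ℝ (fun q => fieldY ε j q * normSq f q) p (dirY j p)) := fun j => by
    rw [fderiv_mul_apply ((hasTemperateGrowth_fieldX hε j).differentiableAt p)
        (normSq f).differentiableAt,
      fderiv_mul_apply ((hasTemperateGrowth_fieldY hε j).differentiableAt p)
        (normSq f).differentiableAt, fderiv_normSq, fderiv_normSq, normSq_apply]
    have hX := norm_sq_add_mul_nonneg (f p) (Xop d j f p) (d * fieldX ε j p)
    have hY := norm_sq_add_mul_nonneg (f p) (Yop d j f p) (d * fieldY ε j p)
    have hdiv := congrArg (d * ‖f p‖ ^ 2 * ·) (fderiv_fieldX_add_fderiv_fieldY hε j p)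
    have hsq := congrArg (d ^ 2 * ‖f p‖ ^ 2 * ·) (fieldX_sq_add_fieldY_sq ε j p)
    have hm : 0 ≤ p.1 j ^ 2 + p.2.1 j ^ 2 := by positivity
    have hw := sub_nonneg.2 (mul_regWeight_sq_le hε p)
    have h1 : 0 ≤ d * ‖f p‖ ^ 2 * (p.1 j ^ 2 + p.2.1 j ^ 2) *
        (regWeight d ε p - (zsq d p ^ 2 + p.2.2 ^ 2) * regWeight d ε p ^ 2) := by positivity
    have h2 : 0 ≤ d ^ 2 * ‖f p‖ ^ 2 * (p.1 j ^ 2 + p.2.1 j ^ 2) *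
        (regWeight d ε p - (zsq d p ^ 2 + p.2.2 ^ 2) * regWeight d ε p ^ 2) := by positivity
    change _ ≤ _ + _ * ((fieldX ε j p * (2 * inner ℝ (f p) (Xop d j f p)) + _) +
      (fieldY ε j p * (2 * inner ℝ (f p) (Yop d j f p)) + _))
    linear_combination hX + hY + 4 * h1 + h2 - hdiv + hsq
  have hsum := Finset.sum_le_sum fun j (_ : j ∈ Finset.univ) => key j
  rw [Finset.sum_sub_distrib, Finset.sum_const, ← Finset.mul_sum, sum_sq_eq_zsq, Finset.sum_add_distrib,
    ← Finset.mul_sum] at hsum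
  simp only [Finset.card_univ, Fintype.card_fin, nsmul_eq_mul] at hsum
  unfold gradHsq
  linarith

theorem regularized_hardy {ε : ℝ} (hε : 0 < ε) (hd : 1 ≤ d) (f : 𝓢(Hd d, ℂ)) :
    ∫⁻ p, ENNReal.ofReal (zsq d p * regWeight d ε p * ‖f p‖ ^ 2) ≤
      ENNReal.ofReal (((d : ℝ)⁻¹) ^ 2) * ∫⁻ p, ENNReal.ofReal (gradHsq d f p) := by
  have hd0 : (0 : ℝ) < d := by exact_mod_cast hd
  have hgrad0 : ∀ p, 0 ≤ gradHsq d f p := fun p => by unfold gradHsq; positivity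
  have hf1 : Continuous (fderiv ℝ f) := (f.smooth 1).continuous_fderiv (by simp)
  have hgradc : Continuous (gradHsq d f) := by
    unfold gradHsq Xop Yop
    fun_prop
  have hmeas : AEStronglyMeasurable (gradHsq d f) volume := hgradc.aestronglyMeasurable
  by_cases htop : ∫⁻ p, ENNReal.ofReal (gradHsq d f p) = ∞
  · rw [htop, ENNReal.mul_top (by positivity)]
    exact le_top
  have hgrad : Integrable (gradHsq d f) :=
    ⟨hmeas, (hasFiniteIntegral_iff_ofReal (ae_of_all _ hgrad0)).2 (lt_top_iff_ne_top.2 htop)⟩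
  obtain ⟨u, hu⟩ := exists_schwartz_mul
    (hasTemperateGrowth_zsq.mul (hasTemperateGrowth_regWeight (d := d) hε)) (normSq f)
  have hup : ∀ p, u p = zsq d p * regWeight d ε p * ‖f p‖ ^ 2 := fun p => by
    rw [hu, ← normSq_apply]; rfl
  have hu0 : ∀ p, 0 ≤ u p := fun p => by
    have := zsq_nonneg p
    have := regWeight_nonneg hε p
    rw [hup]; positivity
  have hX : ∀ j : Fin d,
      Integrable (fun p => fderiv ℝ (fun q => fieldX ε j q * normSq f q) p (dirX j p)) ∧
        ∫ p, fderiv ℝ (fun q => fieldX ε j q * normSq f q) p (dirX j p) = 0 := fun j => by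
    obtain ⟨w, hw⟩ := exists_schwartz_mul (hasTemperateGrowth_fieldX hε j) (normSq f)
    exact hw ▸ integral_fderiv_dirX j w
  have hY : ∀ j : Fin d,
      Integrable (fun p => fderiv ℝ (fun q => fieldY ε j q * normSq f q) p (dirY j p)) ∧
        ∫ p, fderiv ℝ (fun q => fieldY ε j q * normSq f q) p (dirY j p) = 0 := fun j => by
    obtain ⟨w, hw⟩ := exists_schwartz_mul (hasTemperateGrowth_fieldY hε j) (normSq f)
    exact hw ▸ integral_fderiv_dirY j w
  have hXY : ∀ j : Fin d, Integrable fun p =>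
      fderiv ℝ (fun q => fieldX ε j q * normSq f q) p (dirX j p) +
        fderiv ℝ (fun q => fieldY ε j q * normSq f q) p (dirY j p) :=
    fun j => (hX j).1.add (hY j).1
  have hdiv := integrable_finsetSum Finset.univ fun j _ => hXY j
  have hmono := integral_mono (u.integrable.const_mul ((d : ℝ) ^ 2))
    (hgrad.add (hdiv.const_mul d)) fun p => by
      simpa [hup] using pointwise_hardy hε f p
  have hzero : ∫ p, ∑ j : Fin d,
      (fderiv ℝ (fun q => fieldX ε j q * normSq f q) p (dirX j p) +
        fderiv ℝ (fun q => fieldY ε j q * normSq f q) p (dirY j p)) = 0 := by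
    rw [integral_finsetSum _ fun j _ => hXY j]
    refine Finset.sum_eq_zero fun j _ => ?_
    rw [integral_add (hX j).1 (hY j).1, (hX j).2, (hY j).2, add_zero]
  have hfin : ∫ p, u p ≤ ((d : ℝ)⁻¹) ^ 2 * ∫ p, gradHsq d f p := by
    simp only [Pi.add_apply] at hmono
    rw [integral_add hgrad (by simpa using hdiv.const_mul d), integral_const_mul,
      integral_const_mul, hzero, mul_zero, add_zero] at hmono
    rw [inv_pow, ← div_eq_inv_mul, le_div_iff₀ (by positivity)]
    linarith
  simp only [← hup]
  rw [← ofReal_integral_eq_lintegral_ofReal u.integrable (ae_of_all _ hu0),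
    ← ofReal_integral_eq_lintegral_ofReal hgrad (ae_of_all _ hgrad0),
    ← ENNReal.ofReal_mul (by positivity)]
  exact ENNReal.ofReal_le_ofReal hfin

open Filter Topology in
theorem tendsto_zsq_mul_regWeight (p : Hd d) {ε : ℕ → ℝ} (hε : Tendsto ε atTop (𝓝 0)) :
    Tendsto (fun n => zsq d p * regWeight d (ε n) p) atTop
      (𝓝 (zsq d p * (zsq d p ^ 2 + p.2.2 ^ 2)⁻¹)) := by
  by_cases hz : zsq d p = 0
  · simp [hz]
  · have hne : zsq d p ^ 2 + p.2.2 ^ 2 ≠ 0 := by positivity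
    have h : Tendsto (fun n => ε n + zsq d p ^ 2 + p.2.2 ^ 2) atTop
        (𝓝 (zsq d p ^ 2 + p.2.2 ^ 2)) := by
      simpa using (hε.add_const (zsq d p ^ 2)).add_const (p.2.2 ^ 2)
    exact (h.inv₀ hne).const_mul _

end Heisenberg

/-- Hardy-type inequality on the Heisenberg group with the Koranyi weight:
`∫ |z|² (|z|⁴+t²)⁻¹ |f|² ≤ d⁻² ∫ |∇_H f|²` for Schwartz `f`, `d ≥ 1`. -/
theorem hardy_koranyi (d : ℕ) (hd : 1 ≤ d) (f : SchwartzMap (Hd d) ℂ) :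
    ∫⁻ p, ENNReal.ofReal (zsq d p * (zsq d p ^ 2 + p.2.2 ^ 2)⁻¹ * ‖f p‖ ^ 2) ≤
      ENNReal.ofReal (((d : ℝ)⁻¹) ^ 2) * ∫⁻ p, ENNReal.ofReal (gradHsq d (⇑f) p) := by
  have hε : Filter.Tendsto (fun n : ℕ => 1 / ((n : ℝ) + 1)) Filter.atTop (nhds 0) :=
    tendsto_one_div_add_atTop_nhds_zero_nat
  have hε0 : ∀ n : ℕ, (0 : ℝ) < 1 / ((n : ℝ) + 1) := fun n => by positivity
  have hlim : ∀ p, ENNReal.ofReal (zsq d p * (zsq d p ^ 2 + p.2.2 ^ 2)⁻¹ * ‖f p‖ ^ 2) =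
      Filter.liminf (fun n : ℕ => ENNReal.ofReal
        (zsq d p * Heisenberg.regWeight d (1 / ((n : ℝ) + 1)) p * ‖f p‖ ^ 2)) Filter.atTop :=
    fun p => ((ENNReal.continuous_ofReal.tendsto _).comp
      ((Heisenberg.tendsto_zsq_mul_regWeight p hε).mul_const (‖f p‖ ^ 2))).liminf_eq.symm
  simp only [hlim]
  refine (lintegral_liminf_le fun n => ?_).trans ?_
  · have h1 := (Heisenberg.hasTemperateGrowth_zsq (d := d)).1.continuous
    have h2 := (Heisenberg.hasTemperateGrowth_regWeight (d := d) (hε0 n)).1.continuous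
    have h3 := f.continuous
    exact ENNReal.measurable_ofReal.comp ((h1.mul h2).mul (h3.norm.pow 2)).measurable
  · exact Filter.liminf_le_of_le (by isBoundedDefault) fun b hb =>
      let ⟨n, hn⟩ := hb.exists
      hn.trans (Heisenberg.regularized_hardy (hε0 n) hd f)
end
end
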